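/- arXiv:1508.01760 — 3 statements merged into one kernel-verified Lean document; each statement's English description precedes it below -/
import Mathlib

section
/- Let β be a positive integer. There exists a constant C > 0 (depending only on β) such that for all reals x ≥ 3 and y with y > x^{1+β}(log x)^2 one has |C_{1,β}(x,y) − y| ≤ C · x^{1+β} log x. -/
open Complex Finset
open scoped Classical

/-- The generalized Ramanujan sum of Cohen: `c_{q,β}(n) = Σ_h exp(2πinh/q^β)` where `h`
runs over `0 ≤ h < q^β` such that `h` and `q^β` have no common `β`-th power divisor `> 1`. -/
noncomputable def cohenRamanujan (β q n : ℕ) : ℂ :=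
  ∑ h ∈ (Finset.range (q ^ β)).filter
      (fun h => ∀ d : ℕ, 1 < d → ¬(d ^ β ∣ h ∧ d ^ β ∣ q ^ β)),
    Complex.exp (2 * Real.pi * Complex.I * n * h / (q ^ β))

/-- The `k`-th moment of averages `C_{k,β}(x,y) = Σ_{n ≤ y} (Σ_{q ≤ x} c_{q,β}(n))^k`. -/
noncomputable def momentC (k β : ℕ) (x y : ℝ) : ℂ :=
  ∑ n ∈ Finset.Icc 1 ⌊y⌋₊, (∑ q ∈ Finset.Icc 1 ⌊x⌋₊, cohenRamanujan β q n) ^ k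

/-- The geometric sum of `exp(2πinθ)` over `1 ≤ n ≤ N` is at most `1/(2θ) + 1/(2(1-θ))`. -/
theorem norm_sum_exp_two_pi_le (N : ℕ) {θ : ℝ} (h0 : 0 < θ) (h1 : θ < 1) :
    ‖∑ n ∈ Finset.Icc 1 N, Complex.exp (Complex.I * (2 * Real.pi * θ : ℝ)) ^ n‖ ≤
      (1 / θ + 1 / (1 - θ)) / 2 := by
  set z := Complex.exp (Complex.I * (2 * Real.pi * θ : ℝ)) with hz
  have hz1 : ‖z‖ = 1 := by rw [hz, mul_comm, Complex.norm_exp_ofReal_mul_I]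
  have hnorm : ‖z - 1‖ = 2 * Real.sin (Real.pi * θ) := by
    rw [hz, Complex.norm_exp_I_mul_ofReal_sub_one, Real.norm_eq_abs, abs_of_nonneg]
    · congr 2; ring
    · have : 0 ≤ Real.sin (2 * Real.pi * θ / 2) :=
        Real.sin_nonneg_of_nonneg_of_le_pi (by positivity)
          (by nlinarith [Real.pi_pos])
      positivity
  have hsin : 1 / Real.sin (Real.pi * θ) ≤ (1 / θ + 1 / (1 - θ)) / 2 := by
    have hpi := Real.pi_pos
    have hθ' : 0 < 1 - θ := by linarith
    rcases le_total θ (1 / 2) with h | h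
    · have hs : 2 * θ ≤ Real.sin (Real.pi * θ) := by
        have := Real.mul_le_sin (x := Real.pi * θ) (by positivity) (by nlinarith)
        calc 2 * θ = 2 / Real.pi * (Real.pi * θ) := by field_simp
          _ ≤ _ := this
      calc 1 / Real.sin (Real.pi * θ) ≤ 1 / (2 * θ) :=
            one_div_le_one_div_of_le (by positivity) hs
        _ = (1 / θ) / 2 := by field_simp
        _ ≤ _ := by
          have : 0 < 1 / (1 - θ) := by positivity
          linarith
    · have hs : 2 * (1 - θ) ≤ Real.sin (Real.pi * θ) := by
        have := Real.mul_le_sin (x := Real.pi * (1 - θ)) (by positivity) (by nlinarith)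
        rw [show Real.pi * (1 - θ) = Real.pi - Real.pi * θ by ring, Real.sin_pi_sub] at this
        calc 2 * (1 - θ) = 2 / Real.pi * (Real.pi - Real.pi * θ) := by field_simp
          _ ≤ _ := this
      calc 1 / Real.sin (Real.pi * θ) ≤ 1 / (2 * (1 - θ)) :=
            one_div_le_one_div_of_le (by positivity) hs
        _ = (1 / (1 - θ)) / 2 := by field_simp
        _ ≤ _ := by
          have : 0 < 1 / θ := by positivity
          linarith
  have hpos : 0 < Real.sin (Real.pi * θ) :=
    Real.sin_pos_of_pos_of_lt_pi (by positivity) (by nlinarith [Real.pi_pos])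
  have hgeom : (∑ n ∈ Finset.Icc 1 N, z ^ n) * (z - 1) = z * (z ^ N - 1) := by
    rw [← Finset.Ico_add_one_right_eq_Icc, Finset.sum_Ico_eq_sum_range, ← geom_sum_mul,
      ← mul_assoc, Finset.mul_sum]
    simp only [Nat.add_sub_cancel, pow_add, pow_one]
  have hle : ‖∑ n ∈ Finset.Icc 1 N, z ^ n‖ * (2 * Real.sin (Real.pi * θ)) ≤ 2 := by
    rw [← hnorm, ← norm_mul, hgeom, norm_mul, hz1, one_mul]
    calc ‖z ^ N - 1‖ ≤ ‖z ^ N‖ + ‖(1 : ℂ)‖ := norm_sub_le _ _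
      _ = 2 := by rw [norm_pow, hz1]; norm_num
  refine le_trans ?_ hsin
  rw [le_div_iff₀ hpos]
  linarith

/-- The sum over `0 < h < Q` of the bounds for the geometric sums at `h / Q`. -/
theorem sum_inv_add_inv_reflect_le (Q : ℕ) :
    ∑ h ∈ Finset.Ico 1 Q, (1 / ((h : ℝ) / Q) + 1 / (1 - (h : ℝ) / Q)) / 2 ≤
      Q * (1 + Real.log Q) := by
  rcases Nat.eq_zero_or_pos Q with rfl | hQ
  · simp
  have hQ' : (0 : ℝ) < Q := by exact_mod_cast hQ
  have hterm : ∀ h ∈ Finset.Ico 1 Q, (1 / ((h : ℝ) / Q) + 1 / (1 - (h : ℝ) / Q)) / 2 =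
      Q / 2 * ((h : ℝ)⁻¹ + ((Q - h : ℕ) : ℝ)⁻¹) := by
    intro h hh
    rw [Finset.mem_Ico] at hh
    have h1 : (0 : ℝ) < h := by exact_mod_cast hh.1
    have h2 : (0 : ℝ) < Q - h := by
      have : (h : ℝ) < Q := by exact_mod_cast hh.2
      linarith
    rw [Nat.cast_sub hh.2.le]
    have h3 : 1 - (h : ℝ) / Q = (Q - h) / Q := by field_simp
    rw [h3]
    field_simp
  rw [Finset.sum_congr rfl hterm, ← Finset.mul_sum, Finset.sum_add_distrib]
  have hrefl : ∑ h ∈ Finset.Ico 1 Q, ((Q - h : ℕ) : ℝ)⁻¹ = ∑ h ∈ Finset.Ico 1 Q, (h : ℝ)⁻¹ := by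
    refine Finset.sum_bij' (fun h _ => Q - h) (fun h _ => Q - h) ?_ ?_ ?_ ?_ ?_ <;>
      intro h hh <;> simp only [Finset.mem_Ico] at * <;> first | rfl | omega
  have hharm : ∑ h ∈ Finset.Ico 1 Q, (h : ℝ)⁻¹ ≤ 1 + Real.log Q := by
    refine le_trans ?_ (harmonic_le_one_add_log Q)
    rw [harmonic_eq_sum_Icc]
    push_cast
    refine Finset.sum_le_sum_of_subset_of_nonneg ?_ fun i _ _ => by positivity
    intro i hi
    simp only [Finset.mem_Ico, Finset.mem_Icc] at *
    omega
  rw [hrefl]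
  nlinarith

theorem cohenRamanujan_one {β : ℕ} (hβ : 0 < β) (n : ℕ) : cohenRamanujan β 1 n = 1 := by
  have hfilter : (Finset.range (1 ^ β)).filter
      (fun h => ∀ d : ℕ, 1 < d → ¬(d ^ β ∣ h ∧ d ^ β ∣ 1 ^ β)) = {0} := by
    rw [one_pow, Finset.range_one, Finset.filter_eq_self]
    rintro h - d hd ⟨-, hdvd⟩
    exact absurd (Nat.dvd_one.1 hdvd) (Nat.one_lt_pow hβ.ne' hd).ne'
  unfold cohenRamanujan
  rw [hfilter]
  simp

theorem norm_sum_cohenRamanujan_le {β q : ℕ} (hq : 1 < q) (N : ℕ) :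
    ‖∑ n ∈ Finset.Icc 1 N, cohenRamanujan β q n‖ ≤
      (q ^ β : ℕ) * (1 + Real.log (q ^ β : ℕ)) := by
  refine le_trans ?_ (sum_inv_add_inv_reflect_le (q ^ β))
  unfold cohenRamanujan
  rw [Finset.sum_comm]
  refine (norm_sum_le _ _).trans ?_
  have hsub : (Finset.range (q ^ β)).filter
      (fun h => ∀ d : ℕ, 1 < d → ¬(d ^ β ∣ h ∧ d ^ β ∣ q ^ β)) ⊆ Finset.Ico 1 (q ^ β) := by
    intro h hh
    rw [Finset.mem_filter, Finset.mem_range] at hh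
    refine Finset.mem_Ico.2 ⟨Nat.one_le_iff_ne_zero.2 ?_, hh.1⟩
    rintro rfl
    exact hh.2 q hq ⟨dvd_zero _, dvd_rfl⟩
  have hθ : ∀ h ∈ Finset.Ico 1 (q ^ β),
      0 < (h : ℝ) / (q ^ β : ℕ) ∧ (h : ℝ) / (q ^ β : ℕ) < 1 := by
    intro h hh
    rw [Finset.mem_Ico] at hh
    have h1 : (0 : ℝ) < h := by exact_mod_cast hh.1
    have h2 : (h : ℝ) < (q ^ β : ℕ) := by exact_mod_cast hh.2
    exact ⟨div_pos h1 (h1.trans h2), (div_lt_one (h1.trans h2)).2 h2⟩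
  refine (Finset.sum_le_sum fun h hh => ?_).trans
    (Finset.sum_le_sum_of_subset_of_nonneg hsub fun h hh _ => ?_)
  · obtain ⟨h0, h1⟩ := hθ h (hsub hh)
    refine le_trans (le_of_eq ?_) (norm_sum_exp_two_pi_le N h0 h1)
    congr 1
    refine Finset.sum_congr rfl fun n _ => ?_
    rw [← Complex.exp_nat_mul]
    congr 1
    push_cast
    ring
  · obtain ⟨h0, h1⟩ := hθ h hh
    have := sub_pos.2 h1
    positivity

theorem first_moment_basic (β : ℕ) (hβ : 0 < β) :
    ∃ C > 0, ∀ x y : ℝ, 3 ≤ x → x ^ (1 + β) * (Real.log x) ^ 2 < y →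
      ‖momentC 1 β x y - (y : ℂ)‖ ≤ C * (x ^ (1 + β) * Real.log x) := by
  refine ⟨β + 2, by positivity, fun x y hx hy => ?_⟩
  have hx0 : 0 < x := by linarith
  have hy0 : 0 ≤ y := le_trans (by positivity) hy.le
  have hlog : 1 ≤ Real.log x := by
    rw [Real.le_log_iff_exp_le hx0]
    linarith [Real.exp_one_lt_d9]
  have hX : 1 ≤ ⌊x⌋₊ := Nat.one_le_floor_iff _ |>.2 (by linarith)
  have hsplit : momentC 1 β x y - (y : ℂ) =
      (∑ q ∈ Finset.Ioc 1 ⌊x⌋₊, ∑ n ∈ Finset.Icc 1 ⌊y⌋₊, cohenRamanujan β q n) +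
        (((⌊y⌋₊ : ℝ) - y : ℝ) : ℂ) := by
    simp only [momentC, pow_one]
    rw [Finset.sum_comm, ← Finset.add_sum_Ioc_eq_sum_Icc hX]
    simp only [cohenRamanujan_one hβ, Finset.sum_const, Nat.card_Icc]
    push_cast
    simp
    ring
  have hfloor : ‖(((⌊y⌋₊ : ℝ) - y : ℝ) : ℂ)‖ ≤ 1 := by
    rw [Complex.norm_real, Real.norm_eq_abs, abs_le]
    constructor <;> linarith [Nat.floor_le hy0, Nat.lt_floor_add_one y]
  have hterm : ∀ q ∈ Finset.Ioc 1 ⌊x⌋₊,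
      ‖∑ n ∈ Finset.Icc 1 ⌊y⌋₊, cohenRamanujan β q n‖ ≤ x ^ β * (1 + β * Real.log x) := by
    intro q hq
    rw [Finset.mem_Ioc] at hq
    have hqx : (q : ℝ) ≤ x := (Nat.le_floor_iff hx0.le).1 hq.2
    have hq1 : (1 : ℝ) < q := by exact_mod_cast hq.1
    have := Real.log_nonneg hq1.le
    refine (norm_sum_cohenRamanujan_le hq.1 _).trans ?_
    push_cast
    rw [Real.log_pow]
    gcongr
  have hsum : ‖∑ q ∈ Finset.Ioc 1 ⌊x⌋₊, ∑ n ∈ Finset.Icc 1 ⌊y⌋₊, cohenRamanujan β q n‖ ≤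
      x * (x ^ β * (1 + β * Real.log x)) := by
    refine (norm_sum_le_of_le _ hterm).trans ?_
    rw [Finset.sum_const, nsmul_eq_mul, Nat.card_Ioc]
    gcongr
    exact (Nat.cast_le.2 (Nat.sub_le _ _)).trans (Nat.floor_le hx0.le)
  rw [hsplit]
  refine (norm_add_le _ _).trans ((add_le_add hsum hfloor).trans ?_)
  have hpow : 1 ≤ x ^ (1 + β) := one_le_pow₀ (by linarith)
  rw [show x * (x ^ β * (1 + β * Real.log x)) = x ^ (1 + β) * (1 + β * Real.log x) by ring]
  nlinarith [mul_le_mul hpow hlog zero_le_one (by positivity)]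
end

section
/- Let β ∈ {1, 2}. There exists a constant C > 0 such that for all reals x ≥ 3 and y with y ≥ x^{3β/2}(log x)^5 one has |C_{1,β}(x,y) − y + x^{1+β}/(2(1+β)ζ(1+β))| ≤ C · ( x^{β} y^{1/3}(log y)^4 + x^{2β+1} y^{−2/3} + x^{β+1} y^{−1/3} ). -/
open Complex Finset
open scoped Classical

open ArithmeticFunction in
theorem sum_moebius_divisors (n : ℕ) :
    ∑ d ∈ n.divisors, moebius d = if n = 1 then 1 else 0 := by
  have h := congrArg (fun f => f n) moebius_mul_coe_zeta
  simp only [coe_mul_zeta_apply, one_apply] at h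
  simpa using h

theorem sum_range_exp_div (m n : ℕ) (hm : m ≠ 0) :
    ∑ h ∈ range m, exp (2 * Real.pi * I * n * h / m) = if m ∣ n then (m : ℂ) else 0 := by
  have hm' : (m : ℂ) ≠ 0 := by exact_mod_cast hm
  have hpow : ∀ h : ℕ, exp (2 * Real.pi * I * n * h / m) = exp (2 * Real.pi * I * n / m) ^ h := by
    intro h
    rw [← Complex.exp_nat_mul]
    congr 1
    ring
  simp_rw [hpow]
  have hiff : exp (2 * Real.pi * I * n / m) = 1 ↔ m ∣ n := by
    rw [Complex.exp_eq_one_iff]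
    have hpi : (2 * Real.pi * I : ℂ) ≠ 0 := Complex.two_pi_I_ne_zero
    constructor
    · rintro ⟨k, hk⟩
      have : (n : ℂ) = k * m := by
        field_simp at hk
        linear_combination hk
      have h2 : (n : ℤ) = k * m := by exact_mod_cast this
      exact Int.natCast_dvd_natCast.mp ⟨k, by rw [h2, mul_comm]⟩
    · rintro ⟨k, rfl⟩
      refine ⟨k, ?_⟩
      push_cast
      field_simp
  split_ifs with h
  · rw [hiff.mpr h]; simp
  · have h1 := mt hiff.mp h
    rw [geom_sum_eq h1, ← Complex.exp_nat_mul, mul_div_cancel₀ _ hm']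
    have : exp (2 * Real.pi * I * n) = 1 := Complex.exp_eq_one_iff.mpr ⟨n, by push_cast; ring⟩
    rw [this]; simp

theorem exists_dvd_iff_dvd_and_pow_dvd (β q h : ℕ) (hq : q ≠ 0) :
    ∃ D, D ∣ q ∧ ∀ d, d ∣ D ↔ d ∣ q ∧ d ^ β ∣ h := by
  have hne : {d ∈ q.divisors | d ^ β ∣ h}.Nonempty := ⟨1, by simp [hq]⟩
  obtain ⟨D, hD, hmax⟩ := exists_max_image _ id hne
  simp only [mem_filter, Nat.mem_divisors, ne_eq, hq, not_false_eq_true, and_true, id] at hD hmax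
  refine ⟨D, hD.1, fun d => ⟨fun hd => ⟨hd.trans hD.1, (pow_dvd_pow_of_dvd hd β).trans hD.2⟩,
    fun hd => ?_⟩⟩
  have hl := hmax (d.lcm D) ⟨Nat.lcm_dvd hd.1 hD.1, by
    rw [← Nat.pow_lcm_pow]; exact Nat.lcm_dvd hd.2 hD.2⟩
  have hD0 : D ≠ 0 := fun h0 => hq (by simpa [h0] using hD.1)
  have := Nat.le_antisymm hl (Nat.le_of_dvd (Nat.pos_of_ne_zero (Nat.lcm_ne_zero
    (fun h0 => hq (by simpa [h0] using hd.1)) hD0)) (Nat.dvd_lcm_right d D))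
  exact this ▸ Nat.dvd_lcm_left d D

open ArithmeticFunction in
theorem cohenRamanujan_eq_sum_divisors (β q n : ℕ) (hβ : β ≠ 0) (hq : q ≠ 0) :
    cohenRamanujan β q n =
      ∑ d ∈ q.divisors, (moebius d : ℂ) * if (q / d) ^ β ∣ n then ((q / d : ℕ) : ℂ) ^ β else 0 := by
  have hind : ∀ h : ℕ, (if ∀ d : ℕ, 1 < d → ¬(d ^ β ∣ h ∧ d ^ β ∣ q ^ β) then (1 : ℂ) else 0) =
      ∑ d ∈ q.divisors, if d ^ β ∣ h then (moebius d : ℂ) else 0 := by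
    intro h
    obtain ⟨D, hDq, hD⟩ := exists_dvd_iff_dvd_and_pow_dvd β q h hq
    have hD0 : D ≠ 0 := fun h0 => hq (by simpa [h0] using hDq)
    rw [← sum_filter]
    have hset : {d ∈ q.divisors | d ^ β ∣ h} = D.divisors := by
      ext d
      simp [hq, hD0, hD d]
    rw [hset]
    have := sum_moebius_divisors D
    have h2 : (∑ d ∈ D.divisors, (moebius d : ℂ)) = if D = 1 then 1 else 0 := by
      exact_mod_cast congrArg (Int.cast : ℤ → ℂ) this
    rw [h2]
    refine if_congr ?_ rfl rfl
    simp only [Nat.pow_dvd_pow_iff hβ]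
    constructor
    · intro hall
      by_contra h1
      exact hall D (by omega) (((hD D).mp dvd_rfl).symm)
    · rintro rfl d hd hdd
      have := (hD d).mpr hdd.symm
      simp at this
      omega
  unfold cohenRamanujan
  rw [sum_filter]
  have : ∀ h ∈ range (q ^ β), (if ∀ d : ℕ, 1 < d → ¬(d ^ β ∣ h ∧ d ^ β ∣ q ^ β) then
      exp (2 * Real.pi * I * n * h / (q ^ β)) else 0) =
      ∑ d ∈ q.divisors, (if d ^ β ∣ h then (moebius d : ℂ) else 0) *
        exp (2 * Real.pi * I * n * h / (q ^ β)) := by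
    intro h _
    rw [← sum_mul, ← hind]
    split_ifs <;> simp
  rw [sum_congr rfl this, sum_comm]
  refine sum_congr rfl fun d hd => ?_
  obtain ⟨e, he⟩ := (Nat.mem_divisors.mp hd).1
  have hd0 : d ≠ 0 := by rintro rfl; simp at he; exact hq he
  have he0 : e ≠ 0 := by rintro rfl; simp at he; exact hq he
  have hqd : q / d = e := by rw [he]; exact Nat.mul_div_cancel_left e (Nat.pos_of_ne_zero hd0)
  rw [hqd]
  have hs := sum_range_exp_div (e ^ β) n (pow_ne_zero _ he0)
  push_cast at hs
  rw [← hs, mul_sum]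
  simp_rw [ite_mul, zero_mul]
  rw [← sum_filter]
  symm
  refine sum_bij (fun h _ => d ^ β * h) ?_ ?_ ?_ ?_
  · intro h hh
    simp only [mem_filter, mem_range] at hh ⊢
    refine ⟨?_, dvd_mul_right _ _⟩
    rw [he, mul_pow]
    exact Nat.mul_lt_mul_of_pos_left hh (by positivity)
  · intro a _ b _ hab
    exact Nat.eq_of_mul_eq_mul_left (by positivity) hab
  · intro b hb
    simp only [mem_filter, mem_range] at hb
    obtain ⟨c, rfl⟩ := hb.2
    refine ⟨c, ?_, rfl⟩
    have := hb.1
    rw [he, mul_pow] at this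
    exact mem_range.mpr (lt_of_mul_lt_mul_left this (by positivity))
  · intro h _
    have hd' : (d : ℂ) ≠ 0 := by exact_mod_cast hd0
    have he' : (e : ℂ) ≠ 0 := by exact_mod_cast he0
    congr 2
    rw [he]
    push_cast
    field_simp
    ring

theorem sum_Icc_sum_divisors {R : Type*} [AddCommMonoid R] (F : ℕ → ℕ → R) (N : ℕ) :
    ∑ q ∈ Icc 1 N, ∑ d ∈ q.divisors, F d (q / d) =
      ∑ k ∈ Icc 1 N, ∑ d ∈ Icc 1 (N / k), F k d := by
  rw [sum_sigma', sum_sigma']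
  refine sum_bij' (fun p _ => ⟨p.2, p.1 / p.2⟩) (fun p _ => ⟨p.1 * p.2, p.1⟩) ?_ ?_ ?_ ?_ ?_
  · rintro ⟨q, d⟩ h
    simp only [mem_sigma, mem_Icc, Nat.mem_divisors] at h ⊢
    have hd := Nat.pos_of_dvd_of_pos h.2.1 (by omega)
    have := Nat.le_of_dvd (by omega) h.2.1
    exact ⟨⟨hd, by omega⟩, Nat.div_pos this hd, Nat.div_le_div_right h.1.2⟩
  · rintro ⟨k, d⟩ h
    simp only [mem_sigma, mem_Icc, Nat.mem_divisors] at h ⊢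
    have := (Nat.le_div_iff_mul_le (by omega)).mp h.2.2
    refine ⟨⟨Nat.mul_pos (by omega) (by omega), by rw [mul_comm]; exact this⟩, dvd_mul_right _ _,
      (Nat.mul_pos (by omega) (by omega)).ne'⟩
  · rintro ⟨q, d⟩ h
    simp only [mem_sigma, mem_Icc, Nat.mem_divisors] at h ⊢
    simp [Nat.mul_div_cancel' h.2.1]
  · rintro ⟨k, d⟩ h
    simp only [mem_sigma, mem_Icc] at h ⊢
    simp [Nat.mul_div_cancel_left d (show 0 < k by omega)]
  · rintro ⟨q, d⟩ h
    rfl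

open ArithmeticFunction in
theorem momentC_one_eq (β : ℕ) (hβ : β ≠ 0) (x y : ℝ) :
    momentC 1 β x y = ((∑ k ∈ Icc 1 ⌊x⌋₊, (moebius k : ℝ) * ∑ d ∈ Icc 1 (⌊x⌋₊ / k),
      (d : ℝ) ^ β * (⌊y / (d : ℝ) ^ β⌋₊ : ℝ) : ℝ) : ℂ) := by
  unfold momentC
  simp only [pow_one]
  rw [sum_comm]
  have h1 : ∀ q ∈ Icc 1 ⌊x⌋₊, ∑ n ∈ Icc 1 ⌊y⌋₊, cohenRamanujan β q n =
      ∑ d ∈ q.divisors, (moebius d : ℂ) * (((q / d : ℕ) : ℂ) ^ β *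
        (⌊y / ((q / d : ℕ) : ℝ) ^ β⌋₊ : ℂ)) := by
    intro q hq
    have hq0 : q ≠ 0 := by simp at hq; omega
    simp_rw [cohenRamanujan_eq_sum_divisors β q _ hβ hq0]
    rw [sum_comm]
    refine sum_congr rfl fun d _ => ?_
    rw [← mul_sum, ← sum_filter, sum_const, nsmul_eq_mul, mul_comm (_ ^ _)]
    congr 3
    have := Nat.Ioc_filter_dvd_card_eq_div ⌊y⌋₊ ((q / d) ^ β)
    rw [← Nat.cast_pow, Nat.floor_div_natCast, ← this]
    rfl
  rw [sum_congr rfl h1, sum_Icc_sum_divisors (fun k d => (moebius k : ℂ) * ((d : ℂ) ^ β *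
        (⌊y / (d : ℝ) ^ β⌋₊ : ℂ)))]
  push_cast
  simp_rw [mul_sum]

open ArithmeticFunction in
theorem sum_moebius_mul_div (N : ℕ) (hN : N ≠ 0) :
    ∑ k ∈ Icc 1 N, (moebius k : ℝ) * ((N / k : ℕ) : ℝ) = 1 := by
  have h := sum_Icc_sum_divisors (fun k _ => (moebius k : ℝ)) N
  simp only [sum_const, Nat.card_Icc, Nat.add_sub_cancel, nsmul_eq_mul] at h
  simp_rw [mul_comm]
  rw [← h]
  have : ∀ q ∈ Icc 1 N, ∑ d ∈ q.divisors, (moebius d : ℝ) = if q = 1 then 1 else 0 := by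
    intro q _
    exact_mod_cast congrArg (Int.cast : ℤ → ℝ) (sum_moebius_divisors q)
  rw [sum_congr rfl this]
  simp
  omega

/-- The sawtooth function `{t} - 1/2`. -/
noncomputable def sawtooth (t : ℝ) : ℝ := Int.fract t - 1 / 2

theorem abs_sawtooth_le (t : ℝ) : |sawtooth t| ≤ 1 / 2 := by
  unfold sawtooth
  rw [abs_le]
  constructor <;> linarith [Int.fract_nonneg t, Int.fract_lt_one t]

theorem image_range_emod (q : ℕ) (hq : 0 < q) (a g : ℤ) (ha : IsCoprime a q) :
    (range q).image (fun m : ℕ => ((g + a * m) % q).toNat) = range q := by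
  have hq' : (0 : ℤ) < q := by exact_mod_cast hq
  have hnn : ∀ t : ℤ, 0 ≤ t % q := fun t => Int.emod_nonneg _ hq'.ne'
  refine eq_of_subset_of_card_le ?_ ?_
  · intro j hj
    simp only [mem_image, mem_range] at hj ⊢
    obtain ⟨m, -, rfl⟩ := hj
    have := Int.emod_lt_of_pos (g + a * m) hq'
    have := hnn (g + a * m)
    omega
  · rw [card_image_of_injOn]
    intro m hm m' hm' h
    simp only [coe_range, Set.mem_Iio] at hm hm'
    have h1 : (g + a * m) % q = (g + a * m') % q := by
      have := hnn (g + a * m)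
      have := hnn (g + a * m')
      simp only at h
      omega
    have h2 : (q : ℤ) ∣ a * ((m' : ℤ) - m) := by
      have h3 := Int.ModEq.dvd h1
      convert h3 using 1
      ring
    have h4 := ha.symm.dvd_of_dvd_mul_left h2
    have h5 := Int.eq_zero_of_abs_lt_dvd h4 (by rw [abs_lt]; omega)
    omega

theorem sum_sawtooth_add_mul_div (q : ℕ) (hq : 0 < q) (a : ℤ) (ha : IsCoprime a q) (γ : ℝ) :
    ∑ m ∈ range q, sawtooth (γ + a * m / q) = sawtooth (q * γ) := by
  have hq' : (0 : ℤ) < q := by exact_mod_cast hq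
  have hqR : (0 : ℝ) < q := by exact_mod_cast hq
  set g := ⌊(q : ℝ) * γ⌋ with hg
  set θ := Int.fract ((q : ℝ) * γ) with hθ
  have hgθ : (q : ℝ) * γ = g + θ := (Int.floor_add_fract _).symm
  have hfr : ∀ m : ℕ, Int.fract (γ + a * m / q) =
      ((((g + a * m) % q).toNat : ℕ) : ℝ) / q + θ / q := by
    intro m
    have hnn : 0 ≤ (g + a * m) % q := Int.emod_nonneg _ hq'.ne'
    have hlt : (g + a * m) % q + 1 ≤ q := Int.emod_lt_of_pos (g + a * m) hq'
    have hcast : ((((g + a * m) % q).toNat : ℕ) : ℝ) = (((g + a * m) % q : ℤ) : ℝ) := by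
      exact_mod_cast congrArg (Int.cast : ℤ → ℝ) (Int.toNat_of_nonneg hnn)
    rw [hcast, ← add_div]
    have hltR : (((g + a * m) % q : ℤ) : ℝ) + 1 ≤ q := by exact_mod_cast hlt
    have hnnR : (0 : ℝ) ≤ (((g + a * m) % q : ℤ) : ℝ) := by exact_mod_cast hnn
    have hθ0 : 0 ≤ θ := Int.fract_nonneg _
    have hθ1 : θ < 1 := Int.fract_lt_one _
    rw [Int.fract_eq_iff]
    refine ⟨by positivity, ?_, (g + a * m) / q, ?_⟩
    · rw [div_lt_one hqR]; linarith
    · have h1 : (q : ℝ) * (((g + a * m) / q : ℤ) : ℝ) + (((g + a * m) % q : ℤ) : ℝ) = g + a * m := by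
        exact_mod_cast congrArg (Int.cast : ℤ → ℝ) (Int.mul_ediv_add_emod (g + a * m) q)
      field_simp
      linarith
  have hsum : ∑ m ∈ range q, ((((g + a * m) % q).toNat : ℕ) : ℝ) = (q : ℝ) * (q - 1) / 2 := by
    have hcard := image_range_emod q hq a g ha
    have hinj : Set.InjOn (fun m : ℕ => ((g + a * m) % q).toNat) (range q : Set ℕ) := by
      rw [← card_image_iff, hcard]
    have h1 := sum_image (f := fun j : ℕ => (j : ℝ)) hinj
    rw [← h1, hcard]
    have h2 := Finset.sum_range_id_mul_two q
    have h3 : ((∑ i ∈ range q, i : ℕ) : ℝ) * 2 = q * (q - 1) := by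
      rw [← Nat.cast_pred hq]
      exact_mod_cast h2
    push_cast at h3
    linarith
  unfold sawtooth
  simp_rw [hfr]
  rw [sum_sub_distrib, sum_add_distrib, ← sum_div, hsum]
  simp only [sum_const, card_range, nsmul_eq_mul]
  field_simp
  ring

theorem sawtooth_le_of_abs_sub_le {s t δ : ℝ} (h : |s - t| ≤ δ) :
    sawtooth s ≤ sawtooth (t - δ) + 2 * δ ∧ sawtooth (t + δ) - 2 * δ ≤ sawtooth s := by
  rw [abs_le] at h
  have h1 : (⌊t - δ⌋ : ℝ) ≤ ⌊s⌋ := by exact_mod_cast Int.floor_mono (by linarith)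
  have h2 : (⌊s⌋ : ℝ) ≤ ⌊t + δ⌋ := by exact_mod_cast Int.floor_mono (by linarith)
  unfold sawtooth Int.fract
  constructor <;> linarith

theorem abs_sum_sawtooth_le_of_near_linear (q : ℕ) (hq : 0 < q) (a : ℤ) (ha : IsCoprime a q)
    (γ δ : ℝ) (u : ℕ → ℝ) (hu : ∀ m < q, |u m - (γ + a * m / q)| ≤ δ) :
    |∑ m ∈ range q, sawtooth (u m)| ≤ 1 / 2 + 2 * q * δ := by
  have hb := fun m hm => sawtooth_le_of_abs_sub_le (hu m (mem_range.mp hm))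
  have h1 := sum_le_sum fun m hm => (hb m hm).1
  have h2 := sum_le_sum fun m hm => (hb m hm).2
  have e1 := sum_sawtooth_add_mul_div q hq a ha (γ - δ)
  have e2 := sum_sawtooth_add_mul_div q hq a ha (γ + δ)
  simp_rw [add_right_comm γ δ] at e2
  simp_rw [sub_add_eq_add_sub] at e1
  rw [sum_add_distrib, e1] at h1
  rw [sum_sub_distrib, e2] at h2
  simp only [sum_const, card_range, nsmul_eq_mul] at h1 h2
  have a1 := abs_le.mp (abs_sawtooth_le (q * (γ - δ)))
  have a2 := abs_le.mp (abs_sawtooth_le (q * (γ + δ)))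
  rw [abs_le]
  constructor <;> linarith [a1.2, a2.1]

theorem exists_short_block (y : ℝ) (hy : 0 < y) (M τ : ℕ) (hτ : 0 < τ)
    (hM : (τ : ℝ) ^ 3 * y ≤ (M : ℝ) ^ 3) (n : ℕ) (hn : M ≤ n) :
    ∃ q : ℕ, 0 < q ∧ q ≤ τ ∧ |∑ m ∈ range q, sawtooth (y / ((n + m : ℕ) : ℝ))| ≤ 5 ∧
      ∀ m < q, |q * y / ((n + m : ℕ) : ℝ) ^ 2 - round (q * y / ((n + m : ℕ) : ℝ) ^ 2)| ≤ 3 / τ := by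
  have hτR : (0 : ℝ) < τ := by exact_mod_cast hτ
  have hMpos : (0 : ℝ) < M := by
    by_contra h
    have : (M : ℝ) = 0 := le_antisymm (not_lt.mp h) (Nat.cast_nonneg _)
    rw [this] at hM
    have : 0 < (τ : ℝ) ^ 3 * y := by positivity
    norm_num at hM
    linarith
  have hnM : (M : ℝ) ≤ n := by exact_mod_cast hn
  have hnpos : (0 : ℝ) < n := hMpos.trans_le hnM
  have hyn : y / (n : ℝ) ^ 3 ≤ 1 / (τ : ℝ) ^ 3 := by
    rw [div_le_div_iff₀ (by positivity) (by positivity)]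
    have : (M : ℝ) ^ 3 ≤ (n : ℝ) ^ 3 := by gcongr
    linarith
  obtain ⟨r, hr, hrτ⟩ := Real.exists_rat_abs_sub_le_and_den_le (y / (n : ℝ) ^ 2) hτ
  set q := r.den with hqdef
  have hq : 0 < q := r.den_pos
  have hqR : (0 : ℝ) < q := by exact_mod_cast hq
  have hqτ : (q : ℝ) ≤ τ := by exact_mod_cast hrτ
  have hrR : (r : ℝ) = r.num / q := by exact_mod_cast (Rat.num_div_den r).symm
  have hr' : |y / (n : ℝ) ^ 2 - r.num / q| ≤ 1 / (τ * q) := by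
    rw [← hrR]
    refine hr.trans ?_
    gcongr
    linarith
  have hcop : IsCoprime (-r.num) (q : ℤ) :=
    (Int.isCoprime_iff_gcd_eq_one.mpr (by simpa [Int.gcd] using r.reduced)).neg_left
  refine ⟨q, hq, hrτ, ?_, ?_⟩
  · have hu : ∀ m < q, |y / ((n + m : ℕ) : ℝ) - (y / n + ((-r.num : ℤ) : ℝ) * m / q)| ≤ 2 / τ := by
      intro m hm
      have hmR : (m : ℝ) ≤ q := by exact_mod_cast hm.le
      have hm0 : (0 : ℝ) ≤ m := Nat.cast_nonneg _
      have hid : y / ((n + m : ℕ) : ℝ) - (y / n + ((-r.num : ℤ) : ℝ) * m / q) =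
          -(m * (y / (n : ℝ) ^ 2 - r.num / q)) + y * m ^ 2 / ((n : ℝ) ^ 2 * (n + m)) := by
        push_cast
        field_simp
        ring
      have h1 : |(m : ℝ) * (y / (n : ℝ) ^ 2 - r.num / q)| ≤ 1 / τ := by
        rw [abs_mul, abs_of_nonneg hm0]
        calc (m : ℝ) * |y / (n : ℝ) ^ 2 - r.num / q| ≤ q * (1 / (τ * q)) := by gcongr
          _ = 1 / τ := by field_simp
      have h2 : |y * m ^ 2 / ((n : ℝ) ^ 2 * (n + m))| ≤ 1 / τ := by
        rw [abs_of_nonneg (by positivity)]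
        calc y * m ^ 2 / ((n : ℝ) ^ 2 * (n + m)) ≤ y * τ ^ 2 / ((n : ℝ) ^ 2 * n) := by
              gcongr
              · exact hm.le.trans hrτ
              · linarith
          _ = y / (n : ℝ) ^ 3 * τ ^ 2 := by ring
          _ ≤ 1 / (τ : ℝ) ^ 3 * τ ^ 2 := by gcongr
          _ = 1 / τ := by field_simp
      rw [hid]
      refine (abs_add_le _ _).trans ?_
      rw [abs_neg]
      calc _ ≤ 1 / (τ : ℝ) + 1 / τ := add_le_add h1 h2
        _ = 2 / τ := by ring
    refine (abs_sum_sawtooth_le_of_near_linear q hq (-r.num) hcop (y / n) (2 / τ) _ hu).trans ?_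
    have : (q : ℝ) * (2 / τ) ≤ 2 := by
      rw [mul_div_assoc', div_le_iff₀ hτR]
      linarith
    linarith
  · intro m hm
    have hmR : (m : ℝ) ≤ q := by exact_mod_cast hm.le
    have hm0 : (0 : ℝ) ≤ m := Nat.cast_nonneg _
    refine (round_le _ r.num).trans ?_
    have hid : q * y / ((n + m : ℕ) : ℝ) ^ 2 - r.num =
        q * (y / (n : ℝ) ^ 2 - r.num / q) - q * (y * m * (2 * n + m) / ((n : ℝ) ^ 2 * (n + m) ^ 2)) := by
      push_cast
      field_simp
      ring
    have h1 : |(q : ℝ) * (y / (n : ℝ) ^ 2 - r.num / q)| ≤ 1 / τ := by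
      rw [abs_mul, abs_of_pos hqR]
      calc (q : ℝ) * |y / (n : ℝ) ^ 2 - r.num / q| ≤ q * (1 / (τ * q)) := by gcongr
        _ = 1 / τ := by field_simp
    have h2 : |(q : ℝ) * (y * m * (2 * n + m) / ((n : ℝ) ^ 2 * (n + m) ^ 2))| ≤ 2 / (τ : ℝ) := by
      rw [abs_of_nonneg (by positivity)]
      have h3 : (2 * n + m) / ((n : ℝ) ^ 2 * (n + m) ^ 2) ≤ 2 / (n : ℝ) ^ 3 := by
        rw [div_le_div_iff₀ (by positivity) (by positivity)]
        have : (0 : ℝ) ≤ n ^ 2 * (3 * n * m + 2 * m ^ 2) := by positivity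
        nlinarith
      calc (q : ℝ) * (y * m * (2 * n + m) / ((n : ℝ) ^ 2 * (n + m) ^ 2))
          = q * m * y * ((2 * n + m) / ((n : ℝ) ^ 2 * (n + m) ^ 2)) := by ring
        _ ≤ τ * τ * y * (2 / (n : ℝ) ^ 3) := by
            gcongr
            exact hm.le.trans hrτ
        _ = 2 * τ ^ 2 * (y / (n : ℝ) ^ 3) := by ring
        _ ≤ 2 * τ ^ 2 * (1 / (τ : ℝ) ^ 3) := by gcongr
        _ = 2 / τ := by field_simp
    rw [hid]
    refine (abs_sub _ _).trans ?_
    calc _ ≤ 1 / (τ : ℝ) + 2 / τ := add_le_add h1 h2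
      _ = 3 / τ := by ring

/-- The sum of `1 / q` over those `q ≤ τ` for which `q * y / d ^ 2` is within `3 / τ` of an
integer. -/
noncomputable def approxWeight (y : ℝ) (τ d : ℕ) : ℝ :=
  ∑ q ∈ Icc 1 τ, if |q * y / (d : ℝ) ^ 2 - round (q * y / (d : ℝ) ^ 2)| ≤ 3 / τ
    then 1 / (q : ℝ) else 0

theorem approxWeight_nonneg (y : ℝ) (τ d : ℕ) : 0 ≤ approxWeight y τ d :=
  sum_nonneg fun q _ => by split_ifs <;> positivity

theorem abs_sum_Ico_sawtooth_le (f : ℕ → ℝ) (a b : ℕ) :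
    |∑ d ∈ Ico a b, sawtooth (f d)| ≤ ((b - a : ℕ) : ℝ) / 2 := by
  refine (abs_sum_le_sum_abs _ _).trans ((sum_le_sum fun d _ => abs_sawtooth_le _).trans ?_)
  simp only [sum_const, Nat.card_Ico, nsmul_eq_mul]
  linarith

theorem abs_sum_sawtooth_le_sum_approxWeight (y : ℝ) (hy : 0 < y) (M τ : ℕ) (hτ : 0 < τ)
    (hM : (τ : ℝ) ^ 3 * y ≤ (M : ℝ) ^ 3) (L n : ℕ) (hn : M ≤ n) :
    |∑ d ∈ Ico n (n + L), sawtooth (y / (d : ℝ))| ≤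
      5 * ∑ d ∈ Ico n (n + L), approxWeight y τ d + τ := by
  induction L using Nat.strong_induction_on generalizing n with
  | _ L ih =>
  obtain ⟨q, hq, hqτ, hsum, hnear⟩ := exists_short_block y hy M τ hτ hM n hn
  rcases lt_or_ge L q with hL | hL
  · refine (abs_sum_Ico_sawtooth_le _ _ _).trans ?_
    have h1 : 0 ≤ ∑ d ∈ Ico n (n + L), approxWeight y τ d :=
      sum_nonneg fun d _ => approxWeight_nonneg y τ d
    have h2 : (L : ℝ) ≤ τ := by exact_mod_cast hL.le.trans hqτ
    rw [Nat.add_sub_cancel_left]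
    have : (0 : ℝ) ≤ L := Nat.cast_nonneg _
    linarith
  · have hih := ih (L - q) (by omega) (n + q) (by omega)
    rw [show n + q + (L - q) = n + L by omega] at hih
    rw [← sum_Ico_consecutive _ (show n ≤ n + q by omega) (show n + q ≤ n + L by omega),
      ← sum_Ico_consecutive (approxWeight y τ) (show n ≤ n + q by omega)
        (show n + q ≤ n + L by omega)]
    have h1 : |∑ d ∈ Ico n (n + q), sawtooth (y / (d : ℝ))| ≤ 5 := by
      rw [sum_Ico_eq_sum_range, Nat.add_sub_cancel_left]
      exact hsum
    have h2 : 1 ≤ ∑ d ∈ Ico n (n + q), approxWeight y τ d := by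
      rw [sum_Ico_eq_sum_range, Nat.add_sub_cancel_left]
      have hqR : (0 : ℝ) < q := by exact_mod_cast hq
      calc (1 : ℝ) = ∑ m ∈ range q, 1 / (q : ℝ) := by
            simp only [sum_const, card_range, nsmul_eq_mul]; field_simp
        _ ≤ _ := by
          refine sum_le_sum fun m hm => ?_
          have := single_le_sum (f := fun q : ℕ =>
            if |q * y / ((n + m : ℕ) : ℝ) ^ 2 - round (q * y / ((n + m : ℕ) : ℝ) ^ 2)| ≤ 3 / τ
              then 1 / (q : ℝ) else 0) (fun i _ => by split_ifs <;> positivity)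
            (mem_Icc.mpr ⟨hq, hqτ⟩)
          simp only [if_pos (hnear m (mem_range.mp hm))] at this
          exact this
    refine (abs_add_le _ _).trans ?_
    linarith

theorem card_le_of_forall_sub_le (S : Finset ℕ) (R : ℝ) (hR : 0 ≤ R)
    (h : ∀ d ∈ S, ∀ e ∈ S, d ≤ e → (e : ℝ) - d ≤ R) : (#S : ℝ) ≤ R + 1 := by
  rcases S.eq_empty_or_nonempty with rfl | hS
  · simp; linarith
  · have hsub : S ⊆ Icc (S.min' hS) (S.max' hS) := fun d hd =>
      mem_Icc.mpr ⟨S.min'_le d hd, S.le_max' d hd⟩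
    have h1 := card_le_card hsub
    have h2 := h _ (S.min'_mem hS) _ (S.max'_mem hS) (S.min'_le _ (S.max'_mem hS))
    have h3 := S.min'_le _ (S.max'_mem hS)
    rw [Nat.card_Icc, Nat.sub_add_comm h3] at h1
    have h4 : (#S : ℝ) ≤ ((S.max' hS - S.min' hS : ℕ) : ℝ) + 1 := by exact_mod_cast h1
    rw [Nat.cast_sub h3] at h4
    linarith

theorem sub_mul_le_of_div_sq_sub_le {t M d e δ : ℝ} (ht : 0 < t) (hM : 0 < M) (hMd : M ≤ d)
    (hde : d ≤ e) (he : e ≤ 2 * M) (h : t / d ^ 2 - t / e ^ 2 ≤ 2 * δ) :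
    e - d ≤ 8 * δ * M ^ 3 / t := by
  have hd : 0 < d := hM.trans_le hMd
  have he0 : 0 < e := hd.trans_le hde
  have h1 : d * e ≤ M * (d + e) := by nlinarith
  have h2 : d * e ≤ 4 * M ^ 2 := by nlinarith
  have h3 : d ^ 2 * e ^ 2 ≤ 4 * M ^ 3 * (d + e) := by
    calc d ^ 2 * e ^ 2 = (d * e) * (d * e) := by ring
      _ ≤ (M * (d + e)) * (4 * M ^ 2) := by gcongr
      _ = _ := by ring
  have h4 : (e - d) / (4 * M ^ 3) ≤ 1 / d ^ 2 - 1 / e ^ 2 := by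
    rw [div_sub_div _ _ (by positivity) (by positivity), div_le_div_iff₀ (by positivity)
      (by positivity)]
    calc (e - d) * (d ^ 2 * e ^ 2) ≤ (e - d) * (4 * M ^ 3 * (d + e)) := by
          gcongr
      _ = _ := by ring
  have h5 : t * ((e - d) / (4 * M ^ 3)) ≤ 2 * δ := by
    calc _ ≤ t * (1 / d ^ 2 - 1 / e ^ 2) := by gcongr
      _ = t / d ^ 2 - t / e ^ 2 := by ring
      _ ≤ _ := h
  rw [le_div_iff₀ ht]
  have h6 : t * (e - d) = t * ((e - d) / (4 * M ^ 3)) * (4 * M ^ 3) := by field_simp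
  calc (e - d) * t = t * ((e - d) / (4 * M ^ 3)) * (4 * M ^ 3) := by rw [← h6]; ring
    _ ≤ 2 * δ * (4 * M ^ 3) := by gcongr
    _ = _ := by ring

theorem card_near_integer_le (t δ : ℝ) (ht : 0 < t) (hδ : 0 ≤ δ) (M N : ℕ) (hM : 0 < M)
    (hN : N ≤ 2 * M + 1) :
    (#{d ∈ Ico M N | |t / ((d : ℕ) : ℝ) ^ 2 - round (t / (d : ℝ) ^ 2)| ≤ δ} : ℝ) ≤
      (8 * δ * M ^ 3 / t + 1) * (t / M ^ 2 + 2 * δ + 1) := by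
  have hMR : (0 : ℝ) < M := by exact_mod_cast hM
  set S := {d ∈ Ico M N | |t / ((d : ℕ) : ℝ) ^ 2 - round (t / (d : ℝ) ^ 2)| ≤ δ} with hS
  have hmem : ∀ d ∈ S, (M : ℝ) ≤ d ∧ (d : ℝ) ≤ 2 * M ∧
      |t / (d : ℝ) ^ 2 - round (t / (d : ℝ) ^ 2)| ≤ δ := by
    intro d hd
    simp only [hS, mem_filter, mem_Ico] at hd
    exact ⟨by exact_mod_cast hd.1.1, by exact_mod_cast (show d ≤ 2 * M by omega), hd.2⟩
  set T : Finset ℤ := Icc ⌈-δ⌉ ⌊t / (M : ℝ) ^ 2 + δ⌋ with hT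
  have hmaps : ∀ d ∈ S, round (t / (d : ℝ) ^ 2) ∈ T := by
    intro d hd
    obtain ⟨h1, h2, h3⟩ := hmem d hd
    have h4 := abs_le.mp h3
    have h5 : t / (d : ℝ) ^ 2 ≤ t / (M : ℝ) ^ 2 := by gcongr
    have h6 : 0 ≤ t / (d : ℝ) ^ 2 := by positivity
    rw [hT, mem_Icc, Int.ceil_le, Int.le_floor]
    constructor <;> linarith [h4.1, h4.2]
  have hR : 0 ≤ 8 * δ * M ^ 3 / t := by positivity
  have hfib : ∀ a ∈ T, #{d ∈ S | round (t / ((d : ℕ) : ℝ) ^ 2) = a} ≤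
      ⌊8 * δ * M ^ 3 / t + 1⌋₊ := by
    intro a _
    rw [Nat.le_floor_iff (by positivity)]
    refine card_le_of_forall_sub_le _ _ hR fun d hd e he hde => ?_
    rw [mem_filter] at hd he
    obtain ⟨d1, d2, d3⟩ := hmem d hd.1
    obtain ⟨e1, e2, e3⟩ := hmem e he.1
    rw [hd.2] at d3
    rw [he.2] at e3
    refine sub_mul_le_of_div_sq_sub_le ht hMR d1 (by exact_mod_cast hde) e2 ?_
    linarith [(abs_le.mp d3).2, (abs_le.mp e3).1]
  have hcard := card_le_mul_card_image_of_maps_to hmaps _ hfib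
  have hcT : (#T : ℝ) ≤ t / M ^ 2 + 2 * δ + 1 := by
    have h0 : 0 ≤ t / (M : ℝ) ^ 2 := by positivity
    rw [hT, Int.card_Icc]
    have h1 : ((⌊t / (M : ℝ) ^ 2 + δ⌋ + 1 - ⌈-δ⌉ : ℤ) : ℝ) ≤ t / M ^ 2 + 2 * δ + 1 := by
      push_cast
      linarith [Int.floor_le (t / (M : ℝ) ^ 2 + δ), Int.le_ceil (-δ)]
    rcases le_total 0 (⌊t / (M : ℝ) ^ 2 + δ⌋ + 1 - ⌈-δ⌉) with h2 | h2
    · have h3 : ((((⌊t / (M : ℝ) ^ 2 + δ⌋ + 1 - ⌈-δ⌉).toNat : ℕ) : ℤ) : ℝ) =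
          ((⌊t / (M : ℝ) ^ 2 + δ⌋ + 1 - ⌈-δ⌉ : ℤ) : ℝ) := by rw [Int.toNat_of_nonneg h2]
      rw [Int.cast_natCast] at h3
      rw [h3]
      exact h1
    · rw [Int.toNat_of_nonpos h2]
      push_cast
      linarith
  calc (#S : ℝ) ≤ (⌊8 * δ * M ^ 3 / t + 1⌋₊ : ℝ) * #T := by exact_mod_cast hcard
    _ ≤ _ := by
      gcongr
      exact Nat.floor_le (by positivity)

theorem sum_inv_Icc_le (n : ℕ) : ∑ q ∈ Icc 1 n, (q : ℝ)⁻¹ ≤ 1 + Real.log n := by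
  have h := harmonic_le_one_add_log n
  rw [harmonic_eq_sum_Icc] at h
  push_cast at h
  exact h

theorem sum_inv_sq_Icc_le (n : ℕ) : ∑ q ∈ Icc 1 n, ((q : ℝ) ^ 2)⁻¹ ≤ 2 := by
  have h := sum_Ioo_inv_sq_le (α := ℝ) 0 (n + 1)
  have : Ioo 0 (n + 1) = Icc 1 n := by ext; simp; omega
  rw [this] at h
  simpa using h

theorem sum_approxWeight_le (y : ℝ) (hy : 0 < y) (M N τ : ℕ) (hM : 0 < M) (hN : N ≤ 2 * M + 1)
    (hτ : 0 < τ) :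
    ∑ d ∈ Ico M N, approxWeight y τ d ≤
      (24 * (M / τ) + 7) * (1 + Real.log τ) + τ * y / M ^ 2 + 336 * M ^ 3 / (y * τ) := by
  have hMR : (0 : ℝ) < M := by exact_mod_cast hM
  have hτR : (0 : ℝ) < τ := by exact_mod_cast hτ
  have hτ1 : (1 : ℝ) ≤ τ := by exact_mod_cast hτ
  unfold approxWeight
  rw [sum_comm]
  calc _ ≤ ∑ q ∈ Icc 1 τ, ((24 * (M / τ) + 7) * (q : ℝ)⁻¹ + y / M ^ 2 +
        168 * M ^ 3 / (y * τ) * ((q : ℝ) ^ 2)⁻¹) := by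
        refine sum_le_sum fun q hq => ?_
        have hq0 : (0 : ℝ) < q := by
          have := (mem_Icc.mp hq).1
          exact_mod_cast this
        rw [← sum_filter, sum_const, nsmul_eq_mul]
        have h1 := card_near_integer_le (q * y) (3 / τ) (by positivity) (by positivity) M N hM hN
        have h2 : (3 : ℝ) / τ ≤ 3 := div_le_self (by norm_num) hτ1
        calc _ ≤ (8 * (3 / τ) * (M : ℝ) ^ 3 / (q * y) + 1) * (q * y / M ^ 2 + 2 * (3 / τ) + 1) *
              (1 / q) := by gcongr
          _ ≤ (8 * (3 / τ) * (M : ℝ) ^ 3 / (q * y) + 1) * (q * y / M ^ 2 + 2 * 3 + 1) *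
              (1 / q) := by gcongr
          _ = _ := by field_simp; ring
    _ = (24 * (M / τ) + 7) * ∑ q ∈ Icc 1 τ, (q : ℝ)⁻¹ + τ * y / M ^ 2 +
        168 * M ^ 3 / (y * τ) * ∑ q ∈ Icc 1 τ, ((q : ℝ) ^ 2)⁻¹ := by
        rw [sum_add_distrib, sum_add_distrib, ← mul_sum, ← mul_sum]
        simp only [sum_const, Nat.card_Icc, Nat.add_sub_cancel, nsmul_eq_mul]
        ring
    _ ≤ (24 * (M / τ) + 7) * (1 + Real.log τ) + τ * y / M ^ 2 +
        168 * M ^ 3 / (y * τ) * 2 := by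
        gcongr
        · exact sum_inv_Icc_le τ
        · exact sum_inv_sq_Icc_le τ
    _ = _ := by ring

theorem abs_sum_sawtooth_block_le (z : ℝ) (hz : 1 ≤ z) (M N : ℕ) (hM : 0 < M) (hMN : M ≤ N)
    (hN : N ≤ 2 * M + 1) (hMz : (M : ℝ) ≤ z ^ 3) :
    |∑ d ∈ Ico M N, sawtooth (z ^ 3 / (d : ℝ))| ≤
      280 * z * (1 + Real.log (z ^ 3)) + 3361 * (M : ℝ) ^ 2 / z ^ 2 := by
  have hMR : (0 : ℝ) < M := by exact_mod_cast hM
  have hz0 : 0 < z := by linarith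
  have hlog : 0 ≤ Real.log (z ^ 3) := Real.log_nonneg (one_le_pow₀ hz)
  rcases lt_or_ge (M : ℝ) z with h | h
  · refine (abs_sum_Ico_sawtooth_le _ _ _).trans ?_
    have h1 : ((N - M : ℕ) : ℝ) ≤ M + 1 := by exact_mod_cast (show N - M ≤ M + 1 by omega)
    have h2 : 0 ≤ 3361 * (M : ℝ) ^ 2 / z ^ 2 := by positivity
    have h3 : 0 ≤ z * Real.log (z ^ 3) := by positivity
    nlinarith
  · set τ := ⌊(M : ℝ) / z⌋₊ with hτdef
    have hMz1 : 1 ≤ (M : ℝ) / z := by rwa [one_le_div hz0]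
    have hτ : 0 < τ := Nat.floor_pos.mpr hMz1
    have hτR : (0 : ℝ) < τ := by exact_mod_cast hτ
    have hτ1 : (1 : ℝ) ≤ τ := by exact_mod_cast hτ
    have hτle : (τ : ℝ) ≤ M / z := Nat.floor_le (by positivity)
    have hτlt : (M : ℝ) / z < τ + 1 := Nat.lt_floor_add_one _
    have hMτ : (M : ℝ) ≤ 2 * z * τ := by
      rw [div_lt_iff₀ hz0] at hτlt
      nlinarith
    have hτM : (τ : ℝ) ≤ M := hτle.trans (div_le_self hMR.le hz)
    have hcond : (τ : ℝ) ^ 3 * z ^ 3 ≤ (M : ℝ) ^ 3 := by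
      rw [← mul_pow]
      gcongr
      rwa [← le_div_iff₀ hz0]
    have h1 := abs_sum_sawtooth_le_sum_approxWeight (z ^ 3) (by positivity) M τ hτ hcond (N - M) M
      le_rfl
    rw [Nat.add_sub_cancel' hMN] at h1
    have h2 := sum_approxWeight_le (z ^ 3) (by positivity) M N τ hM hN hτ
    have hlogτ : Real.log τ ≤ Real.log (z ^ 3) := Real.log_le_log hτR (hτM.trans hMz)
    have hlogτ0 : 0 ≤ Real.log τ := Real.log_nonneg hτ1
    have t1 : (24 * ((M : ℝ) / τ) + 7) * (1 + Real.log τ) ≤ 55 * z * (1 + Real.log (z ^ 3)) := by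
      have : (M : ℝ) / τ ≤ 2 * z := by rwa [div_le_iff₀ hτR]
      gcongr
      linarith
    have t2 : τ * z ^ 3 / (M : ℝ) ^ 2 ≤ z := by
      rw [div_le_iff₀ (by positivity)]
      calc (τ : ℝ) * z ^ 3 = (τ * z) * (z * z) := by ring
        _ ≤ M * (z * M) := by
          gcongr
          rwa [← le_div_iff₀ hz0]
        _ = _ := by ring
    have t3 : 336 * (M : ℝ) ^ 3 / (z ^ 3 * τ) ≤ 672 * M ^ 2 / z ^ 2 := by
      rw [div_le_div_iff₀ (by positivity) (by positivity)]
      calc 336 * (M : ℝ) ^ 3 * z ^ 2 = 336 * M ^ 2 * z ^ 2 * M := by ring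
        _ ≤ 336 * M ^ 2 * z ^ 2 * (2 * z * τ) := by gcongr
        _ = _ := by ring
    have t4 : (τ : ℝ) ≤ M ^ 2 / z ^ 2 := by
      calc (τ : ℝ) ≤ M / z := hτle
        _ ≤ (M / z) * (M / z) := le_mul_of_one_le_left (by positivity) hMz1
        _ = _ := by ring
    have t5 : 0 ≤ z * Real.log (z ^ 3) := by positivity
    have t6 : 672 * (M : ℝ) ^ 2 / z ^ 2 = 672 * (M ^ 2 / z ^ 2) := by ring
    have t7 : 3361 * (M : ℝ) ^ 2 / z ^ 2 = 3361 * (M ^ 2 / z ^ 2) := by ring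
    rw [t7]
    rw [t6] at t3
    nlinarith

theorem abs_sum_sawtooth_le (z : ℝ) (hz : 1 ≤ z) (N : ℕ) (hN : (N : ℝ) ≤ z ^ 3) :
    |∑ d ∈ Icc 1 N, sawtooth (z ^ 3 / (d : ℝ))| ≤
      280 * z * (1 + Real.log (z ^ 3)) * (Nat.log 2 N + 1) + 5000 * (N : ℝ) ^ 2 / z ^ 2 := by
  have hz0 : 0 < z := by linarith
  have hlog : 0 ≤ Real.log (z ^ 3) := Real.log_nonneg (one_le_pow₀ hz)
  induction N using Nat.strong_induction_on with
  | _ N ih =>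
  rcases lt_or_ge N 2 with h | h
  · have hIcc : Icc 1 N = Ico 1 (N + 1) := rfl
    rw [hIcc]
    refine (abs_sum_Ico_sawtooth_le _ _ _).trans ?_
    have h1 : ((N + 1 - 1 : ℕ) : ℝ) ≤ 1 := by exact_mod_cast (show N + 1 - 1 ≤ 1 by omega)
    have h2 : (0 : ℝ) ≤ Nat.log 2 N := Nat.cast_nonneg _
    have h3 : 0 ≤ 5000 * (N : ℝ) ^ 2 / z ^ 2 := by positivity
    have h4 : 1 ≤ z * (1 + Real.log (z ^ 3)) := one_le_mul_of_one_le_of_one_le hz (by linarith)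
    have h5 : 1 ≤ z * (1 + Real.log (z ^ 3)) * (Nat.log 2 N + 1) :=
      one_le_mul_of_one_le_of_one_le h4 (by linarith)
    linarith
  · have hhalf : ((N / 2 : ℕ) : ℝ) ≤ N / 2 := Nat.cast_div_le
    have hN0 : (0 : ℝ) ≤ N := Nat.cast_nonneg _
    have hih := ih (N / 2) (by omega) (by linarith)
    have hM : ((N / 2 + 1 : ℕ) : ℝ) ≤ N := by exact_mod_cast (show N / 2 + 1 ≤ N by omega)
    have hblock := abs_sum_sawtooth_block_le z hz (N / 2 + 1) (N + 1) (by omega) (by omega)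
      (by omega) (hM.trans hN)
    have hsplit : ∑ d ∈ Icc 1 N, sawtooth (z ^ 3 / (d : ℝ)) =
        ∑ d ∈ Icc 1 (N / 2), sawtooth (z ^ 3 / (d : ℝ)) +
          ∑ d ∈ Ico (N / 2 + 1) (N + 1), sawtooth (z ^ 3 / (d : ℝ)) :=
      (sum_Ico_consecutive _ (by omega) (by omega)).symm
    have hl : Nat.log 2 N = Nat.log 2 (N / 2) + 1 := by
      rw [Nat.log_of_one_lt_of_le (by norm_num) h]
    rw [hsplit, hl]
    refine (abs_add_le _ _).trans ((add_le_add hih hblock).trans ?_)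
    have e1 : ((N / 2 : ℕ) : ℝ) ^ 2 / z ^ 2 ≤ N ^ 2 / z ^ 2 / 4 := by
      calc ((N / 2 : ℕ) : ℝ) ^ 2 / z ^ 2 ≤ (N / 2 : ℝ) ^ 2 / z ^ 2 := by gcongr
        _ = _ := by ring
    have e2 : ((N / 2 + 1 : ℕ) : ℝ) ^ 2 / z ^ 2 ≤ N ^ 2 / z ^ 2 := by gcongr
    have e3 : 0 ≤ (N : ℝ) ^ 2 / z ^ 2 := by positivity
    simp only [mul_div_assoc]
    push_cast at e2 ⊢
    linarith

theorem sum_Icc_mul_eq (s : ℕ → ℝ) (N : ℕ) :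
    ∑ d ∈ Icc 1 N, (d : ℝ) * s d =
      N * ∑ d ∈ Icc 1 N, s d - ∑ m ∈ range N, ∑ d ∈ Icc 1 m, s d := by
  induction N with
  | zero => simp
  | succ N ih =>
    rw [sum_Icc_succ_top (by omega), sum_Icc_succ_top (by omega), sum_range_succ, ih]
    push_cast
    ring

theorem abs_sum_Icc_mul_le (s : ℕ → ℝ) (N : ℕ) (B : ℝ)
    (h : ∀ m ≤ N, |∑ d ∈ Icc 1 m, s d| ≤ B) :
    |∑ d ∈ Icc 1 N, (d : ℝ) * s d| ≤ 2 * N * B := by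
  rw [sum_Icc_mul_eq]
  refine (abs_sub _ _).trans ?_
  have h1 : |(N : ℝ) * ∑ d ∈ Icc 1 N, s d| ≤ N * B := by
    rw [abs_mul, Nat.abs_cast]
    gcongr
    exact h N le_rfl
  have h2 : |∑ m ∈ range N, ∑ d ∈ Icc 1 m, s d| ≤ N * B := by
    refine (abs_sum_le_sum_abs _ _).trans ((sum_le_sum fun m hm =>
      h m (mem_range.mp hm).le).trans ?_)
    simp
  linarith

theorem abs_sum_mul_sawtooth_le (z : ℝ) (hz : 1 ≤ z) (N : ℕ) (hN : (N : ℝ) ≤ z ^ 3) :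
    |∑ d ∈ Icc 1 N, (d : ℝ) * sawtooth (z ^ 3 / (d : ℝ))| ≤
      2 * N * (560 * z * (1 + Real.log (z ^ 3)) ^ 2 + 5000 * (N : ℝ) ^ 2 / z ^ 2) := by
  refine abs_sum_Icc_mul_le _ N _ fun m hm => ?_
  have hz0 : 0 < z := by linarith
  have hlog : 0 ≤ Real.log (z ^ 3) := Real.log_nonneg (one_le_pow₀ hz)
  have hmN : (m : ℝ) ≤ N := by exact_mod_cast hm
  refine (abs_sum_sawtooth_le z hz m (hmN.trans hN)).trans ?_
  have hl : (Nat.log 2 m : ℝ) + 1 ≤ 2 * (1 + Real.log (z ^ 3)) := by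
    rcases Nat.eq_zero_or_pos m with rfl | hm0
    · simp only [Nat.log_zero_right, Nat.cast_zero]; linarith
    · have hm0R : (0 : ℝ) < m := by exact_mod_cast hm0
      have h1 : ((2 ^ Nat.log 2 m : ℕ) : ℝ) ≤ m := by exact_mod_cast Nat.pow_log_le_self 2 hm0.ne'
      have h2 := Real.log_le_log (by positivity) (h1.trans (hmN.trans hN))
      push_cast at h2
      rw [Real.log_pow] at h2
      have h3 := Real.log_two_gt_d9
      have h4 : (0 : ℝ) ≤ Nat.log 2 m := Nat.cast_nonneg _
      nlinarith
  calc 280 * z * (1 + Real.log (z ^ 3)) * (Nat.log 2 m + 1) + 5000 * (m : ℝ) ^ 2 / z ^ 2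
      ≤ 280 * z * (1 + Real.log (z ^ 3)) * (2 * (1 + Real.log (z ^ 3))) +
        5000 * (N : ℝ) ^ 2 / z ^ 2 := by gcongr
    _ = _ := by ring

open ArithmeticFunction in
theorem abs_moebius_cast_le_one (k : ℕ) : |(moebius k : ℝ)| ≤ 1 := by
  exact_mod_cast abs_moebius_le_one (n := k)

open ArithmeticFunction in
theorem exists_sum_moebius_div_sq_near :
    ∃ Z : ℝ, (Z : ℂ) * riemannZeta 2 = 1 ∧
      ∀ X : ℕ, 0 < X → |∑ k ∈ Icc 1 X, (moebius k : ℝ) / (k : ℝ) ^ 2 - Z| ≤ 1 / X := by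
  have h2 : 1 < (2 : ℂ).re := by norm_num
  have hs := (LSeriesSummable_moebius_iff.mpr h2).LSeriesHasSum
  have hterm : (LSeries.term (fun n => ((moebius n : ℤ) : ℂ)) 2) =
      fun n : ℕ => (((moebius n : ℝ) / (n : ℝ) ^ 2 : ℝ) : ℂ) := by
    ext n
    rcases eq_or_ne n 0 with rfl | hn
    · simp
    · rw [LSeries.term_of_ne_zero hn]
      push_cast
      congr 1
      exact_mod_cast Complex.cpow_natCast (n : ℂ) 2
  rw [LSeriesHasSum, hterm] at hs
  have hre := Complex.hasSum_re hs
  simp only [Complex.ofReal_re] at hre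
  set Z := (LSeries (fun n => ((moebius n : ℤ) : ℂ)) 2).re with hZ
  have hZL : (Z : ℂ) = LSeries (fun n => ((moebius n : ℤ) : ℂ)) 2 :=
    (Complex.hasSum_ofReal.mpr hre).unique hs
  refine ⟨Z, ?_, fun X hX => ?_⟩
  · rw [hZL, ← LSeries_zeta_eq_riemannZeta h2, mul_comm]
    exact LSeries_zeta_mul_Lseries_moebius h2
  · set f : ℕ → ℝ := fun n => (moebius n : ℝ) / (n : ℝ) ^ 2 with hf
    have hsum : ∑ k ∈ Icc 1 X, f k = ∑ k ∈ range (X + 1), f k := by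
      rw [range_eq_Ico, sum_eq_sum_Ico_succ_bot (by omega)]
      simp [hf]
      rfl
    have htend := (hre.tendsto_sum_nat.const_sub (∑ k ∈ Icc 1 X, f k)).abs
    refine le_of_tendsto htend ?_
    filter_upwards [Filter.eventually_ge_atTop (X + 1)] with N hN
    rw [hsum, abs_sub_comm, ← sum_Ico_eq_sub _ hN]
    have hIoc : Ico (X + 1) N = Ioc X (N - 1) := by ext; simp; omega
    rw [hIoc]
    have h1 := sum_Ioc_inv_sq_le_sub (α := ℝ) hX.ne' (show X ≤ N - 1 by omega)
    calc |∑ k ∈ Ioc X (N - 1), f k| ≤ ∑ k ∈ Ioc X (N - 1), |f k| := abs_sum_le_sum_abs _ _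
      _ ≤ ∑ k ∈ Ioc X (N - 1), ((k : ℝ) ^ 2)⁻¹ := by
        refine sum_le_sum fun k _ => ?_
        rw [hf, abs_div, abs_of_nonneg (by positivity : (0 : ℝ) ≤ (k : ℝ) ^ 2), div_eq_mul_inv]
        exact mul_le_of_le_one_left (by positivity) (abs_moebius_cast_le_one k)
      _ ≤ 1 / X := by
        refine h1.trans ?_
        rw [one_div]
        exact sub_le_self _ (by positivity)

open ArithmeticFunction in
theorem sum_moebius_mul_floor_eq (β X : ℕ) (hX : X ≠ 0) (y : ℝ) (hy : 0 ≤ y) :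
    ∑ k ∈ Icc 1 X, (moebius k : ℝ) * ∑ d ∈ Icc 1 (X / k),
      (d : ℝ) ^ β * (⌊y / (d : ℝ) ^ β⌋₊ : ℝ) =
    y - ∑ k ∈ Icc 1 X, (moebius k : ℝ) * ∑ d ∈ Icc 1 (X / k),
      (d : ℝ) ^ β * Int.fract (y / (d : ℝ) ^ β) := by
  rw [eq_sub_iff_add_eq, ← sum_add_distrib]
  simp_rw [← mul_add, ← sum_add_distrib]
  have h : ∀ k ∈ Icc 1 X, (moebius k : ℝ) * ∑ d ∈ Icc 1 (X / k),
      ((d : ℝ) ^ β * (⌊y / (d : ℝ) ^ β⌋₊ : ℝ) + (d : ℝ) ^ β * Int.fract (y / (d : ℝ) ^ β)) =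
      (moebius k : ℝ) * ((X / k : ℕ) : ℝ) * y := by
    intro k _
    rw [mul_assoc]
    congr 1
    rw [sum_congr rfl (g := fun _ => y)]
    · simp
    · intro d hd
      have hd0 : (0 : ℝ) < d := by
        have := (mem_Icc.mp hd).1
        exact_mod_cast this
      rw [← mul_add, natCast_floor_eq_intCast_floor (by positivity), Int.floor_add_fract]
      field_simp
  rw [sum_congr rfl h, ← sum_mul, sum_moebius_mul_div X hX, one_mul]

open ArithmeticFunction in
theorem abs_sum_moebius_mul_sum_sq_fract_le (X : ℕ) (y : ℝ) :
    |∑ k ∈ Icc 1 X, (moebius k : ℝ) * ∑ d ∈ Icc 1 (X / k),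
      (d : ℝ) ^ 2 * Int.fract (y / (d : ℝ) ^ 2)| ≤ 2 * (X : ℝ) ^ 3 := by
  have hX0 : (0 : ℝ) ≤ X := Nat.cast_nonneg _
  have h : ∀ k ∈ Icc 1 X, |(moebius k : ℝ) * ∑ d ∈ Icc 1 (X / k),
      (d : ℝ) ^ 2 * Int.fract (y / (d : ℝ) ^ 2)| ≤ (X : ℝ) ^ 3 * ((k : ℝ) ^ 2)⁻¹ := by
    intro k hk
    have hk1 : (1 : ℝ) ≤ k := by exact_mod_cast (mem_Icc.mp hk).1
    have hk0 : (0 : ℝ) < k := by linarith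
    have hn : ((X / k : ℕ) : ℝ) ≤ X / k := Nat.cast_div_le
    rw [abs_mul]
    refine (mul_le_of_le_one_left (abs_nonneg _) (abs_moebius_cast_le_one k)).trans ?_
    calc |∑ d ∈ Icc 1 (X / k), (d : ℝ) ^ 2 * Int.fract (y / (d : ℝ) ^ 2)|
        ≤ ∑ d ∈ Icc 1 (X / k), ((X / k : ℕ) : ℝ) ^ 2 := by
          refine (abs_sum_le_sum_abs _ _).trans (sum_le_sum fun d hd => ?_)
          rw [abs_of_nonneg (mul_nonneg (by positivity) (Int.fract_nonneg _))]
          have : (d : ℝ) ≤ ((X / k : ℕ) : ℝ) := by exact_mod_cast (mem_Icc.mp hd).2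
          calc _ ≤ (d : ℝ) ^ 2 * 1 := by gcongr; exact (Int.fract_lt_one _).le
            _ ≤ _ := by rw [mul_one]; gcongr
      _ = ((X / k : ℕ) : ℝ) ^ 3 := by simp; ring
      _ ≤ (X / k : ℝ) ^ 3 := by gcongr
      _ = (X : ℝ) ^ 3 * ((k : ℝ) ^ 3)⁻¹ := by rw [div_pow, div_eq_mul_inv]
      _ ≤ _ := by gcongr; norm_num
  refine (abs_sum_le_sum_abs _ _).trans ((sum_le_sum h).trans ?_)
  rw [← mul_sum, mul_comm]
  gcongr
  exact sum_inv_sq_Icc_le X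

open ArithmeticFunction in
theorem abs_sum_moebius_mul_sum_sawtooth_le (z : ℝ) (hz : 1 ≤ z) (X : ℕ) (hX : 0 < X)
    (hXz : (X : ℝ) ≤ z ^ 3) :
    |∑ k ∈ Icc 1 X, (moebius k : ℝ) * ∑ d ∈ Icc 1 (X / k), (d : ℝ) * sawtooth (z ^ 3 / (d : ℝ))| ≤
      1120 * X * z * (1 + Real.log (z ^ 3)) ^ 3 + 20000 * (X : ℝ) ^ 3 / z ^ 2 := by
  have hX0 : (0 : ℝ) < X := by exact_mod_cast hX
  have hz0 : 0 < z := by linarith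
  have hlog : 0 ≤ Real.log (z ^ 3) := Real.log_nonneg (one_le_pow₀ hz)
  have h : ∀ k ∈ Icc 1 X, |(moebius k : ℝ) * ∑ d ∈ Icc 1 (X / k),
      (d : ℝ) * sawtooth (z ^ 3 / (d : ℝ))| ≤
      1120 * X * z * (1 + Real.log (z ^ 3)) ^ 2 * (k : ℝ)⁻¹ +
        10000 * X ^ 3 / z ^ 2 * ((k : ℝ) ^ 2)⁻¹ := by
    intro k hk
    have hk1 : (1 : ℝ) ≤ k := by exact_mod_cast (mem_Icc.mp hk).1
    have hk0 : (0 : ℝ) < k := by linarith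
    have hn : ((X / k : ℕ) : ℝ) ≤ X / k := Nat.cast_div_le
    rw [abs_mul]
    refine (mul_le_of_le_one_left (abs_nonneg _) (abs_moebius_cast_le_one k)).trans ?_
    refine (abs_sum_mul_sawtooth_le z hz (X / k)
      (hn.trans ((div_le_self hX0.le hk1).trans hXz))).trans ?_
    calc 2 * ((X / k : ℕ) : ℝ) * (560 * z * (1 + Real.log (z ^ 3)) ^ 2 +
          5000 * ((X / k : ℕ) : ℝ) ^ 2 / z ^ 2)
        ≤ 2 * (X / k) * (560 * z * (1 + Real.log (z ^ 3)) ^ 2 + 5000 * (X / k) ^ 2 / z ^ 2) := by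
          gcongr
      _ = 1120 * X * z * (1 + Real.log (z ^ 3)) ^ 2 * (k : ℝ)⁻¹ +
        10000 * X ^ 3 / z ^ 2 * ((k : ℝ) ^ 3)⁻¹ := by field_simp; ring
      _ ≤ _ := by gcongr; norm_num
  refine (abs_sum_le_sum_abs _ _).trans ((sum_le_sum h).trans ?_)
  rw [sum_add_distrib, ← mul_sum, ← mul_sum]
  have hlogX : Real.log X ≤ Real.log (z ^ 3) := Real.log_le_log hX0 hXz
  have hinv : ∑ k ∈ Icc 1 X, (k : ℝ)⁻¹ ≤ 1 + Real.log (z ^ 3) := (sum_inv_Icc_le X).trans (by linarith)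
  calc _ ≤ 1120 * X * z * (1 + Real.log (z ^ 3)) ^ 2 * (1 + Real.log (z ^ 3)) +
        10000 * X ^ 3 / z ^ 2 * 2 := by
        gcongr
        exact sum_inv_sq_Icc_le X
    _ = _ := by ring

theorem sum_Icc_cast (n : ℕ) : ∑ d ∈ Icc 1 n, (d : ℝ) = n * (n + 1) / 2 := by
  induction n with
  | zero => simp
  | succ n ih =>
    rw [sum_Icc_succ_top (by omega), ih]
    push_cast
    ring

open ArithmeticFunction in
theorem abs_sum_moebius_mul_sum_sub_le (x Z : ℝ) (hx : 1 ≤ x)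
    (hZ : ∀ X : ℕ, 0 < X → |∑ k ∈ Icc 1 X, (moebius k : ℝ) / (k : ℝ) ^ 2 - Z| ≤ 1 / X) :
    |∑ k ∈ Icc 1 ⌊x⌋₊, (moebius k : ℝ) * ∑ d ∈ Icc 1 (⌊x⌋₊ / k), (d : ℝ) - Z * x ^ 2 / 2| ≤
      2 * x * (1 + Real.log x) := by
  have hx0 : 0 < x := by linarith
  have hX : 0 < ⌊x⌋₊ := Nat.floor_pos.mpr hx
  set X := ⌊x⌋₊ with hXdef
  have hXR : (1 : ℝ) ≤ X := by exact_mod_cast hX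
  have hXx : (X : ℝ) ≤ x := Nat.floor_le hx0.le
  have hxX : x < X + 1 := Nat.lt_floor_add_one x
  have hlogX : Real.log X ≤ Real.log x := Real.log_le_log (by linarith) hXx
  have hlog : 0 ≤ Real.log x := Real.log_nonneg hx
  have hsplit : ∑ k ∈ Icc 1 X, (moebius k : ℝ) * ∑ d ∈ Icc 1 (X / k), (d : ℝ) - Z * x ^ 2 / 2 =
      ∑ k ∈ Icc 1 X, (moebius k : ℝ) * (∑ d ∈ Icc 1 (X / k), (d : ℝ) - (x / k) ^ 2 / 2) +
        x ^ 2 / 2 * (∑ k ∈ Icc 1 X, (moebius k : ℝ) / (k : ℝ) ^ 2 - Z) := by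
    rw [mul_sub, mul_sum]
    simp_rw [mul_sub]
    rw [sum_sub_distrib]
    have : ∀ k ∈ Icc 1 X, (moebius k : ℝ) * ((x / k) ^ 2 / 2) =
        x ^ 2 / 2 * ((moebius k : ℝ) / (k : ℝ) ^ 2) := fun k _ => by
      rw [div_pow]; ring
    rw [sum_congr rfl this]
    ring
  have h1 : ∀ k ∈ Icc 1 X, |(moebius k : ℝ) * (∑ d ∈ Icc 1 (X / k), (d : ℝ) - (x / k) ^ 2 / 2)| ≤
      x * (k : ℝ)⁻¹ := by
    intro k hk
    have hk0 : (0 : ℝ) < k := by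
      have := (mem_Icc.mp hk).1
      exact_mod_cast this
    rw [abs_mul]
    refine (mul_le_of_le_one_left (abs_nonneg _) (abs_moebius_cast_le_one k)).trans ?_
    rw [sum_Icc_cast, ← div_eq_mul_inv]
    have hfl : X / k = ⌊x / k⌋₊ := (Nat.floor_div_natCast x k).symm
    have e1 : ((X / k : ℕ) : ℝ) ≤ x / k := by
      rw [hfl]; exact Nat.floor_le (by positivity)
    have e2 : x / k < ((X / k : ℕ) : ℝ) + 1 := by
      rw [hfl]; exact Nat.lt_floor_add_one _
    have e3 : (0 : ℝ) ≤ ((X / k : ℕ) : ℝ) := Nat.cast_nonneg _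
    have e4 : 0 < x / k := by positivity
    rw [abs_le]
    constructor <;> nlinarith
  have h2 : |x ^ 2 / 2 * (∑ k ∈ Icc 1 X, (moebius k : ℝ) / (k : ℝ) ^ 2 - Z)| ≤ x := by
    rw [abs_mul, abs_of_nonneg (by positivity)]
    calc _ ≤ x ^ 2 / 2 * (1 / X) := by gcongr; exact hZ X hX
      _ ≤ x := by
        rw [mul_one_div, div_le_iff₀ (by linarith)]
        nlinarith
  rw [hsplit]
  refine (abs_add_le _ _).trans ((add_le_add ((abs_sum_le_sum_abs _ _).trans (sum_le_sum h1))
    h2).trans ?_)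
  rw [← mul_sum]
  have h3 : ∑ k ∈ Icc 1 X, (k : ℝ)⁻¹ ≤ 1 + Real.log x := (sum_inv_Icc_le X).trans (by linarith)
  nlinarith [mul_le_mul_of_nonneg_left h3 hx0.le, mul_nonneg hx0.le hlog]

theorem norm_momentC_one_one_le (Z x z : ℝ) (hx : 1 ≤ x) (hxz : x ≤ z ^ 3) (hz : 1 ≤ z)
    (hZ : ∀ X : ℕ, 0 < X →
      |∑ k ∈ Icc 1 X, (ArithmeticFunction.moebius k : ℝ) / (k : ℝ) ^ 2 - Z| ≤ 1 / X) :
    ‖momentC 1 1 x (z ^ 3) - ((z ^ 3 : ℝ) : ℂ) + ((Z * x ^ 2 / 4 : ℝ) : ℂ)‖ ≤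
      1121 * x * z * (1 + Real.log (z ^ 3)) ^ 3 + 20000 * x ^ 3 / z ^ 2 := by
  have hx0 : 0 < x := by linarith
  have hz0 : 0 < z := by linarith
  have hX : 0 < ⌊x⌋₊ := Nat.floor_pos.mpr hx
  have hXx : (⌊x⌋₊ : ℝ) ≤ x := Nat.floor_le hx0.le
  rw [momentC_one_eq 1 one_ne_zero, ← Complex.ofReal_sub, ← Complex.ofReal_add, Complex.norm_real,
    Real.norm_eq_abs, sum_moebius_mul_floor_eq 1 _ hX.ne' _ (by positivity)]
  simp only [pow_one]
  have hsplit : ∑ k ∈ Icc 1 ⌊x⌋₊, (ArithmeticFunction.moebius k : ℝ) *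
      ∑ d ∈ Icc 1 (⌊x⌋₊ / k), (d : ℝ) * Int.fract (z ^ 3 / (d : ℝ)) =
      ∑ k ∈ Icc 1 ⌊x⌋₊, (ArithmeticFunction.moebius k : ℝ) *
        ∑ d ∈ Icc 1 (⌊x⌋₊ / k), (d : ℝ) * sawtooth (z ^ 3 / (d : ℝ)) +
      (∑ k ∈ Icc 1 ⌊x⌋₊, (ArithmeticFunction.moebius k : ℝ) *
        ∑ d ∈ Icc 1 (⌊x⌋₊ / k), (d : ℝ)) / 2 := by
    rw [sum_div, ← sum_add_distrib]
    refine sum_congr rfl fun k _ => ?_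
    rw [mul_div_assoc, ← mul_add, sum_div, ← sum_add_distrib]
    congr 1
    refine sum_congr rfl fun d _ => ?_
    unfold sawtooth
    ring
  rw [hsplit]
  have h1 := abs_sum_moebius_mul_sum_sawtooth_le z hz _ hX (hXx.trans hxz)
  have h2 := abs_sum_moebius_mul_sum_sub_le x Z hx hZ
  set E := ∑ k ∈ Icc 1 ⌊x⌋₊, (ArithmeticFunction.moebius k : ℝ) *
        ∑ d ∈ Icc 1 (⌊x⌋₊ / k), (d : ℝ) * sawtooth (z ^ 3 / (d : ℝ))
  set A := ∑ k ∈ Icc 1 ⌊x⌋₊, (ArithmeticFunction.moebius k : ℝ) *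
        ∑ d ∈ Icc 1 (⌊x⌋₊ / k), (d : ℝ)
  have hlog : 0 ≤ Real.log x := Real.log_nonneg hx
  have hlogz : Real.log x ≤ Real.log (z ^ 3) := Real.log_le_log hx0 hxz
  set ℓ := 1 + Real.log (z ^ 3) with hℓ
  have hℓ1 : 1 ≤ ℓ := by linarith
  have h3 : |E| ≤ 1120 * x * z * ℓ ^ 3 + 20000 * x ^ 3 / z ^ 2 := h1.trans (by gcongr)
  have h4 : |A - Z * x ^ 2 / 2| ≤ 2 * (x * z * ℓ ^ 3) := by
    calc _ ≤ 2 * x * (1 + Real.log x) := h2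
      _ ≤ 2 * x * ℓ := by gcongr; linarith
      _ ≤ 2 * (x * z * ℓ ^ 3) := by
        have : ℓ ≤ ℓ ^ 3 := le_self_pow₀ hℓ1 (by norm_num)
        have h5 : x ≤ x * z := le_mul_of_one_le_right hx0.le hz
        calc 2 * x * ℓ = 2 * (x * ℓ) := by ring
          _ ≤ _ := by gcongr
  rw [abs_le] at h3 h4 ⊢
  constructor <;> linarith [h3.1, h3.2, h4.1, h4.2]

theorem norm_momentC_one_two_le (x y : ℝ) (hx : 1 ≤ x) (hy : 0 ≤ y) :
    ‖momentC 1 2 x y - (y : ℂ)‖ ≤ 2 * x ^ 3 := by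
  have hX : 0 < ⌊x⌋₊ := Nat.floor_pos.mpr hx
  rw [momentC_one_eq 2 two_ne_zero, ← Complex.ofReal_sub, Complex.norm_real, Real.norm_eq_abs,
    sum_moebius_mul_floor_eq 2 _ hX.ne' y hy, sub_sub_cancel_left, abs_neg]
  refine (abs_sum_moebius_mul_sum_sq_fract_le _ y).trans ?_
  gcongr
  exact Nat.floor_le (by linarith)

theorem first_moment_sharp_small_beta (β : ℕ) (hβ : β = 1 ∨ β = 2) :
    ∃ C > 0, ∀ x y : ℝ, 3 ≤ x → x ^ ((3 * (β : ℝ)) / 2) * (Real.log x) ^ 5 ≤ y →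
      ‖momentC 1 β x y - (y : ℂ) +
          ((x ^ (1 + β) : ℝ) : ℂ) / (2 * (1 + (β : ℂ)) * riemannZeta (1 + (β : ℂ)))‖ ≤
        C * (x ^ β * y ^ ((1 : ℝ) / 3) * (Real.log y) ^ 4
          + x ^ (2 * β + 1) * y ^ (-(2 : ℝ) / 3) + x ^ (β + 1) * y ^ (-(1 : ℝ) / 3)) := by
  have hlog3 : ∀ x : ℝ, 3 ≤ x → 1 ≤ Real.log x := fun x hx => by
    rw [Real.le_log_iff_exp_le (by linarith)]
    linarith [Real.exp_one_lt_d9]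
  rcases hβ with rfl | rfl
  · obtain ⟨Z, hZζ, hZ⟩ := exists_sum_moebius_div_sq_near
    refine ⟨20000, by norm_num, fun x y hx hxy => ?_⟩
    have hx0 : 0 < x := by linarith
    have hxy' : x ≤ y := by
      refine le_trans ?_ hxy
      calc x = x ^ (1 : ℝ) * 1 := by simp
        _ ≤ _ := by
          gcongr
          · linarith
          · norm_num
          · exact one_le_pow₀ (hlog3 x hx)
    have hy0 : 0 < y := by linarith
    have hL : 1 ≤ Real.log y := hlog3 y (by linarith)
    set z := y ^ ((1 : ℝ) / 3) with hz
    have hz1 : 1 ≤ z := Real.one_le_rpow (by linarith) (by norm_num)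
    have hz0 : 0 < z := by linarith
    have hz3 : z ^ 3 = y := by
      rw [hz, ← Real.rpow_natCast, ← Real.rpow_mul hy0.le]; norm_num
    have hz2 : y ^ (-(2 : ℝ) / 3) = 1 / z ^ 2 := by
      rw [hz, ← Real.rpow_natCast, ← Real.rpow_mul hy0.le, one_div, ← Real.rpow_neg hy0.le]
      norm_num
    have hmain : ((x ^ (1 + 1) : ℝ) : ℂ) / (2 * (1 + ((1 : ℕ) : ℂ)) * riemannZeta (1 + ((1 : ℕ) : ℂ)))
        = ((Z * x ^ 2 / 4 : ℝ) : ℂ) := by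
      have h2 : (1 + ((1 : ℕ) : ℂ)) = 2 := by norm_num
      have hne : riemannZeta 2 ≠ 0 := right_ne_zero_of_mul_eq_one hZζ
      rw [h2]
      push_cast
      field_simp
      linear_combination (-4 * (x : ℂ) ^ 2) * hZζ
    have h := norm_momentC_one_one_le Z x z (by linarith) (hz3 ▸ hxy') hz1 hZ
    rw [hmain, hz2]
    rw [hz3] at h
    refine h.trans ?_
    have h1 : 0 ≤ x ^ (1 + 1) * y ^ (-(1 : ℝ) / 3) := by positivity
    have h2 : (1 + Real.log y) ^ 3 ≤ 8 * Real.log y ^ 4 := by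
      calc (1 + Real.log y) ^ 3 ≤ (2 * Real.log y) ^ 3 := by gcongr; linarith
        _ = 8 * (Real.log y ^ 3 * 1) := by ring
        _ ≤ 8 * (Real.log y ^ 3 * Real.log y) := by gcongr
        _ = _ := by ring
    have h3 : 1121 * x * z * (1 + Real.log y) ^ 3 ≤ 1121 * x * z * (8 * Real.log y ^ 4) := by gcongr
    have h4 : 0 ≤ x * z * Real.log y ^ 4 := by positivity
    have h5 : 20000 * x ^ 3 / z ^ 2 = 20000 * (x ^ (2 * 1 + 1) * (1 / z ^ 2)) := by ring
    rw [h5, pow_one]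
    linarith
  · set c : ℂ := 1 / (2 * (1 + ((2 : ℕ) : ℂ)) * riemannZeta (1 + ((2 : ℕ) : ℂ))) with hc
    refine ⟨2 + ‖c‖, by positivity, fun x y hx hxy => ?_⟩
    have hx0 : 0 < x := by linarith
    have hxy' : x ^ 3 ≤ y := by
      refine le_trans ?_ hxy
      have h3 : ((3 * ((2 : ℕ) : ℝ)) / 2) = ((3 : ℕ) : ℝ) := by norm_num
      rw [h3, Real.rpow_natCast]
      exact le_mul_of_one_le_right (by positivity) (one_le_pow₀ (hlog3 x hx))
    have hy0 : 0 < y := lt_of_lt_of_le (by positivity) hxy'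
    have hL : 1 ≤ Real.log y := by
      refine (hlog3 x hx).trans (Real.log_le_log hx0 (le_trans ?_ hxy'))
      exact le_self_pow₀ (by linarith) (by norm_num)
    have hxz : x ≤ y ^ ((1 : ℝ) / 3) := by
      calc x = (x ^ 3) ^ ((1 : ℝ) / 3) := by
            rw [← Real.rpow_natCast, ← Real.rpow_mul hx0.le]; norm_num
        _ ≤ _ := by gcongr
    have h1 : 0 ≤ x ^ (2 * 2 + 1) * y ^ (-(2 : ℝ) / 3) := by positivity
    have h2 : 0 ≤ x ^ (2 + 1) * y ^ (-(1 : ℝ) / 3) := by positivity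
    have h3 : x ^ 3 ≤ x ^ 2 * y ^ ((1 : ℝ) / 3) * Real.log y ^ 4 := by
      calc x ^ 3 = x ^ 2 * x * 1 := by ring
        _ ≤ _ := by
          gcongr
          exact one_le_pow₀ hL
    have h4 : ‖((x ^ (1 + 2) : ℝ) : ℂ) / (2 * (1 + ((2 : ℕ) : ℂ)) *
        riemannZeta (1 + ((2 : ℕ) : ℂ)))‖ = x ^ 3 * ‖c‖ := by
      rw [div_eq_mul_one_div, ← hc, norm_mul, Complex.norm_real, Real.norm_eq_abs,
        abs_of_pos (by positivity)]
    refine (norm_add_le _ _).trans ?_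
    rw [h4]
    calc _ ≤ 2 * x ^ 3 + x ^ 3 * ‖c‖ := by
          gcongr
          exact norm_momentC_one_two_le x y (by linarith) hy0.le
      _ = (2 + ‖c‖) * x ^ 3 := by ring
      _ ≤ _ := by
        gcongr
        linarith
end

section
/- Let β ≥ 3 be an integer. There exists a constant C > 0 (depending only on β) such that for all reals x ≥ 3 and y with y > x^{3β/2} one has |C_{2,β}(x,y) − y·x^{1+β}/((1+β)ζ(1+β))| ≤ C · ( x^{2β} y^{1/3 + 1/(6β)} (log y)^5 (log log y) ((log x)^4 + (log log x)^4) + y·x^{1/2+β}((log x)^3 + (log log x)^3) ). -/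
open Complex Finset
open scoped Classical

open ArithmeticFunction in
lemma sum_divisors_dvd_mul_moebius {R : Type*} [Ring R] (e : ℕ) {q : ℕ} (hq : 0 < q) :
    ∑ d ∈ q.divisors, (if e ∣ d then ((moebius (q / d) : ℤ) : R) else 0) = if q = e then 1 else 0 := by
  have key := (sum_eq_iff_sum_mul_moebius_eq (R := R) (f := fun i => if i = e then 1 else 0)
    (g := fun n => if e ∣ n then 1 else 0)).1 (fun n hn => by
      simp [Finset.sum_ite_eq', hn.ne']) q hq
  rw [← key, Nat.sum_divisorsAntidiagonal'
    (f := fun a b => ((moebius a : ℤ) : R) * if e ∣ b then 1 else 0)]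
  simp

/-- Jordan's totient function `J_β`, with real values. -/
noncomputable def jordanTotient (β : ℕ) : ArithmeticFunction ℝ :=
  (ArithmeticFunction.moebius : ArithmeticFunction ℝ) *
    (ArithmeticFunction.pow β : ArithmeticFunction ℝ)

lemma sum_divisors_jordanTotient {β : ℕ} (hβ : β ≠ 0) (n : ℕ) :
    ∑ e ∈ n.divisors, jordanTotient β e = (n : ℝ) ^ β := by
  rw [← ArithmeticFunction.coe_mul_zeta_apply, jordanTotient, mul_right_comm,
    ArithmeticFunction.coe_moebius_mul_coe_zeta, one_mul]
  simp [ArithmeticFunction.pow_apply, hβ]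

open ArithmeticFunction in
lemma sum_divisors_moebius_mul_gcd_pow {β : ℕ} (hβ : β ≠ 0) {q r : ℕ} (hq : 0 < q)
    (hr : 0 < r) :
    ∑ d ∈ q.divisors, ∑ e ∈ r.divisors,
      ((moebius (q / d) : ℤ) : ℝ) * ((moebius (r / e) : ℤ) : ℝ) * (Nat.gcd d e : ℝ) ^ β
      = if q = r then jordanTotient β q else 0 := by
  have hgcd : ∀ d ∈ q.divisors, ∀ e : ℕ, (Nat.gcd d e : ℝ) ^ β =
      ∑ k ∈ q.divisors, if k ∣ d ∧ k ∣ e then jordanTotient β k else 0 := by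
    intro d hd e
    rw [← sum_divisors_jordanTotient hβ, ← Finset.sum_filter]
    refine Finset.sum_congr ?_ fun _ _ => rfl
    ext k
    have hd' := Nat.dvd_of_mem_divisors hd
    have hd0 : d ≠ 0 := (Nat.pos_of_mem_divisors hd).ne'
    simp only [Nat.mem_divisors, Finset.mem_filter, Nat.dvd_gcd_iff]
    exact ⟨fun h => ⟨⟨h.1.1.trans hd', hq.ne'⟩, h.1⟩,
      fun h => ⟨h.2, Nat.gcd_ne_zero_left hd0⟩⟩
  calc _ = ∑ d ∈ q.divisors, ∑ e ∈ r.divisors, ∑ k ∈ q.divisors,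
        jordanTotient β k * ((if k ∣ d then ((moebius (q / d) : ℤ) : ℝ) else 0) *
          (if k ∣ e then ((moebius (r / e) : ℤ) : ℝ) else 0)) := by
        refine Finset.sum_congr rfl fun d hd => Finset.sum_congr rfl fun e _ => ?_
        rw [hgcd d hd e, Finset.mul_sum]
        refine Finset.sum_congr rfl fun k _ => ?_
        split_ifs <;> first | ring1 | (exfalso; tauto)
    _ = ∑ k ∈ q.divisors, jordanTotient β k *
        ((if q = k then 1 else 0) * (if r = k then 1 else 0)) := by
        rw [Finset.sum_congr rfl fun d _ => Finset.sum_comm, Finset.sum_comm]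
        refine Finset.sum_congr rfl fun k _ => ?_
        rw [← sum_divisors_dvd_mul_moebius (R := ℝ) k hq,
          ← sum_divisors_dvd_mul_moebius (R := ℝ) k hr, Finset.sum_mul_sum, Finset.mul_sum]
        simp only [Finset.mul_sum]
    _ = _ := by
        rw [Finset.sum_eq_single q (by intro b _ hb; simp [hb.symm]) (by simp [hq.ne'])]
        simp [eq_comm]

lemma sum_range_exp_eq_ite {N : ℕ} (hN : 0 < N) (n : ℕ) :
    ∑ h ∈ Finset.range N, Complex.exp (2 * Real.pi * Complex.I * n * h / N)
      = if N ∣ n then (N : ℂ) else 0 := by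
  have hN' : (N : ℂ) ≠ 0 := by exact_mod_cast hN.ne'
  have h1 : ∀ h : ℕ, Complex.exp (2 * Real.pi * Complex.I * n * h / N) =
      Complex.exp (2 * Real.pi * Complex.I * n / N) ^ h := by
    intro h
    rw [← Complex.exp_nat_mul]; congr 1; ring
  simp_rw [h1]
  have hpow : Complex.exp (2 * Real.pi * Complex.I * n / N) ^ N = 1 := by
    rw [← Complex.exp_nat_mul, mul_div_cancel₀ _ hN', Complex.exp_eq_one_iff]
    exact ⟨n, by push_cast; ring⟩
  have hiff : Complex.exp (2 * Real.pi * Complex.I * n / N) = 1 ↔ N ∣ n := by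
    rw [Complex.exp_eq_one_iff]
    constructor
    · rintro ⟨k, hk⟩
      have hnk : (n : ℂ) = N * k := by
        have h2 := Complex.two_pi_I_ne_zero
        field_simp at hk
        apply mul_left_cancel₀ h2
        linear_combination (2 * (Real.pi : ℂ) * Complex.I) * hk
      have : (n : ℤ) = N * k := by exact_mod_cast hnk
      exact Int.natCast_dvd_natCast.1 ⟨k, this⟩
    · rintro ⟨k, rfl⟩
      exact ⟨k, by push_cast; field_simp⟩
  split_ifs with h
  · simp [hiff.2 h]
  · rw [geom_sum_eq (mt hiff.1 h), hpow]; simp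

open ArithmeticFunction in
lemma sum_moebius_pow_dvd {β : ℕ} (hβ : β ≠ 0) {q : ℕ} (hq : 0 < q) (h : ℕ) :
    ∑ d ∈ q.divisors, (if d ^ β ∣ h then ((moebius d : ℤ) : ℂ) else 0) =
      if ∀ d : ℕ, 1 < d → ¬(d ^ β ∣ h ∧ d ^ β ∣ q ^ β) then 1 else 0 := by
  obtain ⟨D, hDq, hDiff⟩ : ∃ D : ℕ, D ∣ q ∧ ∀ d, d ∣ D ↔ d ∣ q ∧ d ^ β ∣ h := by
    set S := q.divisors.filter (fun d => d ^ β ∣ h) with hS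
    have hlcm : ∀ T ⊆ S, (T.lcm id) ∣ q ∧ (T.lcm id) ^ β ∣ h := by
      intro T
      induction T using Finset.induction_on with
      | empty => simp
      | insert a T ha ih =>
        intro hT
        obtain ⟨h1, h2⟩ := ih fun x hx => hT (Finset.mem_insert_of_mem hx)
        have haS := hT (Finset.mem_insert_self a T)
        rw [hS, Finset.mem_filter, Nat.mem_divisors] at haS
        rw [Finset.lcm_insert]
        refine ⟨lcm_dvd haS.1.1 h1, ?_⟩
        change (Nat.lcm a _) ^ β ∣ h
        rw [← Nat.pow_lcm_pow]
        exact Nat.lcm_dvd haS.2 h2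
    obtain ⟨h1, h2⟩ := hlcm S subset_rfl
    refine ⟨S.lcm id, h1, fun d => ⟨fun hd => ⟨hd.trans h1, (pow_dvd_pow_of_dvd hd β).trans h2⟩,
      fun hd => ?_⟩⟩
    exact Finset.dvd_lcm (f := id) (by simp [hS, hd.1, hd.2, hq.ne'])
  have hD0 : D ≠ 0 := fun h0 => hq.ne' (by simpa [h0] using hDq)
  have hfil : q.divisors.filter (fun d => d ^ β ∣ h) = D.divisors := by
    ext d; simp [hDiff, hq.ne', hD0]
  rw [← Finset.sum_filter, hfil, ← Int.cast_sum, ← coe_mul_zeta_apply, moebius_mul_coe_zeta,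
    one_apply]
  have : D = 1 ↔ ∀ d : ℕ, 1 < d → ¬(d ^ β ∣ h ∧ d ^ β ∣ q ^ β) := by
    simp only [Nat.pow_dvd_pow_iff hβ]
    constructor
    · rintro rfl d hd ⟨h1, h2⟩
      exact hd.ne' (Nat.dvd_one.1 ((hDiff d).2 ⟨h2, h1⟩))
    · intro H
      by_contra hD1
      exact H D (by omega) ⟨((hDiff D).1 dvd_rfl).2, hDq⟩
  simp only [this]
  split_ifs <;> simp

/-- The Möbius-sum expression of Cohen's generalized Ramanujan sum, with real values. -/
noncomputable def cohenRamanujanReal (β q n : ℕ) : ℝ :=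
  ∑ d ∈ q.divisors, ((ArithmeticFunction.moebius (q / d) : ℤ) : ℝ) *
    (if d ^ β ∣ n then (d : ℝ) ^ β else 0)

lemma cohenRamanujan_eq_ofReal {β : ℕ} (hβ : β ≠ 0) {q : ℕ} (hq : 0 < q) (n : ℕ) :
    cohenRamanujan β q n = (cohenRamanujanReal β q n : ℂ) := by
  have hmul : ∀ d ∈ q.divisors, ∑ h ∈ Finset.range (q ^ β), (if d ^ β ∣ h then
      Complex.exp (2 * Real.pi * Complex.I * n * h / (q ^ β)) else 0) =
      if (q / d) ^ β ∣ n then (((q / d : ℕ) : ℂ)) ^ β else 0 := by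
    intro d hd
    obtain ⟨k, rfl⟩ := Nat.dvd_of_mem_divisors hd
    have hd0 : 0 < d := Nat.pos_of_mem_divisors hd
    have hk0 : 0 < k := Nat.pos_of_mul_pos_left hq
    rw [Nat.mul_div_cancel_left _ hd0]
    have := sum_range_exp_eq_ite (pow_pos hk0 β) n
    push_cast at this
    rw [← this, ← Finset.sum_filter]
    symm
    refine Finset.sum_bij (fun h _ => d ^ β * h) ?_ ?_ ?_ ?_
    · intro h hh
      simp only [Finset.mem_filter, Finset.mem_range] at hh ⊢
      exact ⟨by rw [mul_pow]; exact Nat.mul_lt_mul_of_pos_left hh (pow_pos hd0 β), dvd_mul_right _ _⟩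
    · intro a _ b _ hab
      exact Nat.eq_of_mul_eq_mul_left (pow_pos hd0 β) hab
    · intro b hb
      simp only [Finset.mem_filter, Finset.mem_range] at hb
      obtain ⟨hb, c, rfl⟩ := hb
      rw [mul_pow] at hb
      exact ⟨c, by simpa using Nat.lt_of_mul_lt_mul_left hb, rfl⟩
    · intro h _
      congr 1
      have : (d : ℂ) ≠ 0 := by exact_mod_cast hd0.ne'
      have : (k : ℂ) ≠ 0 := by exact_mod_cast hk0.ne'
      push_cast
      rw [mul_pow]
      field_simp
  calc cohenRamanujan β q n
      = ∑ h ∈ Finset.range (q ^ β), ∑ d ∈ q.divisors,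
        ((ArithmeticFunction.moebius d : ℤ) : ℂ) * (if d ^ β ∣ h then
        Complex.exp (2 * Real.pi * Complex.I * n * h / (q ^ β)) else 0) := by
        rw [cohenRamanujan, Finset.sum_filter]
        refine Finset.sum_congr rfl fun h _ => ?_
        have := congrArg (· * Complex.exp (2 * Real.pi * Complex.I * n * h / (q ^ β)))
          (sum_moebius_pow_dvd hβ hq h)
        simp only [ite_mul, one_mul, zero_mul, Finset.sum_mul] at this
        rw [← this]
        refine Finset.sum_congr rfl fun d _ => ?_
        split_ifs <;> simp
    _ = ∑ d ∈ q.divisors, ((ArithmeticFunction.moebius d : ℤ) : ℂ) *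
        (if (q / d) ^ β ∣ n then (((q / d : ℕ) : ℂ)) ^ β else 0) := by
        rw [Finset.sum_comm]
        refine Finset.sum_congr rfl fun d hd => ?_
        rw [← Finset.mul_sum, hmul d hd]
    _ = _ := by
        rw [cohenRamanujanReal, ← Nat.sum_div_divisors]
        push_cast
        refine Finset.sum_congr rfl fun d hd => ?_
        rw [Nat.div_div_self (Nat.dvd_of_mem_divisors hd) hq.ne']
        split_ifs <;> simp

open ArithmeticFunction in
lemma abs_sum_cohenRamanujanReal_mul_sub_le {β : ℕ} (hβ : β ≠ 0) {q r : ℕ} (hq : 0 < q)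
    (hr : 0 < r) {y : ℝ} (hy : 0 ≤ y) :
    |∑ n ∈ Finset.Icc 1 ⌊y⌋₊, cohenRamanujanReal β q n * cohenRamanujanReal β r n
        - y * (if q = r then jordanTotient β q else 0)|
      ≤ (∑ d ∈ q.divisors, (d : ℝ) ^ β) * ∑ e ∈ r.divisors, (e : ℝ) ^ β := by
  have hcount : ∀ d ∈ q.divisors, ∀ e ∈ r.divisors,
      |∑ n ∈ Finset.Icc 1 ⌊y⌋₊, (if d ^ β ∣ n then (d : ℝ) ^ β else 0) *
        (if e ^ β ∣ n then (e : ℝ) ^ β else 0) - y * (Nat.gcd d e : ℝ) ^ β|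
      ≤ (d : ℝ) ^ β * (e : ℝ) ^ β := by
    intro d hd e he
    have hd0 : 0 < d := Nat.pos_of_mem_divisors hd
    have he0 : 0 < e := Nat.pos_of_mem_divisors he
    set L := Nat.lcm (d ^ β) (e ^ β) with hL
    have hL0 : 0 < L := Nat.lcm_pos (pow_pos hd0 β) (pow_pos he0 β)
    have hLR : (0 : ℝ) < L := by exact_mod_cast hL0
    have h1 : ∑ n ∈ Finset.Icc 1 ⌊y⌋₊, (if d ^ β ∣ n then (d : ℝ) ^ β else 0) *
        (if e ^ β ∣ n then (e : ℝ) ^ β else 0) =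
        (d : ℝ) ^ β * (e : ℝ) ^ β * (⌊y / L⌋₊ : ℝ) := by
      rw [Nat.floor_div_natCast, ← Nat.Ioc_filter_dvd_card_eq_div, Finset.card_eq_sum_ones,
        Finset.sum_filter]
      push_cast
      rw [Finset.mul_sum]
      refine Finset.sum_congr rfl fun n _ => ?_
      have : L ∣ n ↔ d ^ β ∣ n ∧ e ^ β ∣ n := Nat.lcm_dvd_iff
      split_ifs <;> first | (exfalso; tauto) | simp
    have h2 : (d : ℝ) ^ β * (e : ℝ) ^ β = (Nat.gcd d e : ℝ) ^ β * L := by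
      have : d ^ β * e ^ β = (Nat.gcd d e) ^ β * L := by
        rw [← Nat.pow_gcd_pow, hL, Nat.gcd_mul_lcm]
      exact_mod_cast this
    have h3 : y * (Nat.gcd d e : ℝ) ^ β = (d : ℝ) ^ β * (e : ℝ) ^ β * (y / L) := by
      rw [h2]; field_simp
    rw [h1, h3, ← mul_sub, abs_mul, abs_of_nonneg (by positivity)]
    refine mul_le_of_le_one_right (by positivity) ?_
    rw [abs_le]
    have h4 := Nat.floor_le (div_nonneg hy hLR.le)
    have h5 := Nat.lt_floor_add_one (y / L)
    constructor <;> linarith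
  rw [← sum_divisors_moebius_mul_gcd_pow hβ hq hr]
  have hexp : ∑ n ∈ Finset.Icc 1 ⌊y⌋₊, cohenRamanujanReal β q n * cohenRamanujanReal β r n =
      ∑ d ∈ q.divisors, ∑ e ∈ r.divisors,
        ((moebius (q / d) : ℤ) : ℝ) * ((moebius (r / e) : ℤ) : ℝ) *
        ∑ n ∈ Finset.Icc 1 ⌊y⌋₊, (if d ^ β ∣ n then (d : ℝ) ^ β else 0) *
        (if e ^ β ∣ n then (e : ℝ) ^ β else 0) := by
    simp only [cohenRamanujanReal, Finset.sum_mul_sum]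
    rw [Finset.sum_comm]
    refine Finset.sum_congr rfl fun d _ => ?_
    rw [Finset.sum_comm]
    refine Finset.sum_congr rfl fun e _ => ?_
    rw [Finset.mul_sum]
    exact Finset.sum_congr rfl fun n _ => by ring
  rw [hexp, Finset.mul_sum, ← Finset.sum_sub_distrib, Finset.sum_mul_sum]
  refine (Finset.abs_sum_le_sum_abs _ _).trans (Finset.sum_le_sum fun d hd => ?_)
  rw [Finset.mul_sum, ← Finset.sum_sub_distrib]
  refine (Finset.abs_sum_le_sum_abs _ _).trans (Finset.sum_le_sum fun e he => ?_)
  have hmu : ∀ k : ℕ, |((moebius k : ℤ) : ℝ)| ≤ 1 := fun k => by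
    exact_mod_cast abs_moebius_le_one (n := k)
  rw [mul_left_comm, ← mul_sub, abs_mul, abs_mul]
  calc _ ≤ 1 * _ := mul_le_mul_of_nonneg_right
        (mul_le_one₀ (hmu _) (abs_nonneg _) (hmu _)) (abs_nonneg _)
    _ ≤ _ := by rw [one_mul]; exact hcount d hd e he

lemma sum_sum_divisors_pow_le {β : ℕ} (hβ : β ≠ 0) (N : ℕ) :
    ∑ q ∈ Finset.Icc 1 N, ∑ d ∈ q.divisors, (d : ℝ) ^ β ≤ (N : ℝ) ^ (β + 1) := by
  have h := ArithmeticFunction.sum_Ioc_mul_zeta_eq_sum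
    (ArithmeticFunction.pow β : ArithmeticFunction ℝ) N
  simp only [ArithmeticFunction.coe_mul_zeta_apply, ArithmeticFunction.natCoe_apply,
    ArithmeticFunction.pow_apply, hβ, false_and, if_false, Nat.cast_pow] at h
  change ∑ q ∈ Finset.Ioc 0 N, _ ≤ _
  rw [h]
  calc _ ≤ ∑ n ∈ Finset.Ioc 0 N, (N : ℝ) ^ β := by
        refine Finset.sum_le_sum fun n hn => ?_
        rw [Finset.mem_Ioc] at hn
        have : n ^ β * (N / n) ≤ N ^ β := by
          obtain ⟨b, rfl⟩ := Nat.exists_eq_succ_of_ne_zero hβ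
          calc n ^ (b + 1) * (N / n) = n ^ b * (n * (N / n)) := by ring
            _ ≤ N ^ b * N := Nat.mul_le_mul (Nat.pow_le_pow_left hn.2 b) (Nat.mul_div_le N n)
            _ = N ^ (b + 1) := by ring
        exact_mod_cast this
    _ = _ := by simp; ring

lemma abs_sum_pow_sub_le (β : ℕ) {t : ℝ} (ht : 0 ≤ t) :
    |∑ m ∈ Finset.Ioc 0 ⌊t⌋₊, (m : ℝ) ^ β - t ^ (β + 1) / (β + 1)| ≤ t ^ β := by
  have hβ : (0 : ℝ) < (β : ℝ) + 1 := by positivity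
  have hdiff : ∀ {a b : ℝ}, 0 ≤ a → a ≤ b →
      a ^ β * (b - a) ≤ b ^ (β + 1) / (β + 1) - a ^ (β + 1) / (β + 1) ∧
      b ^ (β + 1) / (β + 1) - a ^ (β + 1) / (β + 1) ≤ b ^ β * (b - a) := by
    intro a b ha hab
    have hI : b ^ (β + 1) / (β + 1) - a ^ (β + 1) / (β + 1) = ∫ u in a..b, u ^ β := by
      rw [integral_pow]; ring
    rw [hI]
    have hint : ∀ f : ℝ → ℝ, Continuous f → IntervalIntegrable f MeasureTheory.volume a b :=
      fun f hf => hf.intervalIntegrable _ _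
    constructor
    · calc a ^ β * (b - a) = ∫ _ in a..b, a ^ β := by simp; ring
        _ ≤ _ := intervalIntegral.integral_mono_on hab (hint _ (by fun_prop))
          (hint _ (by fun_prop)) fun u hu => pow_le_pow_left₀ ha hu.1 β
    · calc (∫ u in a..b, u ^ β) ≤ ∫ _ in a..b, b ^ β :=
          intervalIntegral.integral_mono_on hab (hint _ (by fun_prop))
            (hint _ (by fun_prop)) fun u hu => pow_le_pow_left₀ (ha.trans hu.1) hu.2 β
        _ = _ := by simp; ring
  have hnat : ∀ n : ℕ, (n : ℝ) ^ (β + 1) / (β + 1) ≤ ∑ m ∈ Finset.Ioc 0 n, (m : ℝ) ^ β ∧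
      ∑ m ∈ Finset.Ioc 0 n, (m : ℝ) ^ β ≤ (n : ℝ) ^ (β + 1) / (β + 1) + (n : ℝ) ^ β := by
    intro n
    induction n with
    | zero => simp
    | succ n ih =>
      rw [Finset.sum_Ioc_succ_top (Nat.zero_le n)]
      have := hdiff (a := n) (b := (n + 1 : ℕ)) (by positivity) (by simp)
      push_cast at this ⊢
      constructor <;> nlinarith [this.1, this.2, ih.1, ih.2]
  have h0 := Nat.floor_le ht
  have h1 := Nat.lt_floor_add_one t
  have h2 := hdiff (a := ⌊t⌋₊) (by positivity) h0
  have h3 := hnat ⌊t⌋₊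
  have h4 : (⌊t⌋₊ : ℝ) ^ β ≤ t ^ β := pow_le_pow_left₀ (by positivity) h0 β
  have h5 : t ^ β * (t - ⌊t⌋₊) ≤ t ^ β :=
    mul_le_of_le_one_right (by positivity) (by linarith)
  have h6 : 0 ≤ (⌊t⌋₊ : ℝ) ^ β * (t - ⌊t⌋₊) := mul_nonneg (by positivity) (by linarith)
  rw [abs_le]
  constructor <;> linarith [h2.1, h2.2, h3.1, h3.2]

open ArithmeticFunction in
lemma hasSum_moebius_div_pow {k : ℕ} (hk : 1 < k) :
    HasSum (fun n : ℕ => ((moebius n : ℤ) : ℂ) / (n : ℂ) ^ k) (riemannZeta k)⁻¹ := by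
  have hs : 1 < (k : ℂ).re := by simpa using hk
  have h1 := (LSeriesSummable_moebius_iff.2 hs).LSeriesHasSum
  have h2 : LSeries (fun n => ((moebius n : ℤ) : ℂ)) k = (riemannZeta k)⁻¹ := by
    have := LSeries_one_mul_Lseries_moebius hs
    rw [LSeries_one_eq_riemannZeta hs] at this
    exact eq_inv_of_mul_eq_one_right this
  rw [h2] at h1
  refine h1.congr_fun fun n => ?_
  rcases eq_or_ne n 0 with rfl | hn
  · simp
  · rw [LSeries.term_of_ne_zero hn, Complex.cpow_natCast]

open ArithmeticFunction in
lemma exists_norm_sum_jordanTotient_sub_le {β : ℕ} (hβ : 1 < β) :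
    ∃ K : ℝ, 0 ≤ K ∧ ∀ x : ℝ, 0 ≤ x →
      ‖((∑ q ∈ Finset.Icc 1 ⌊x⌋₊, jordanTotient β q : ℝ) : ℂ) -
        ((x ^ (1 + β) : ℝ) : ℂ) / ((1 + (β : ℂ)) * riemannZeta (1 + (β : ℂ)))‖ ≤ K * x ^ β := by
  have hsum : Summable fun n : ℕ => 1 / (n : ℝ) ^ β := Real.summable_one_div_nat_pow.2 hβ
  refine ⟨∑' n : ℕ, 1 / (n : ℝ) ^ β, tsum_nonneg fun n => by positivity, fun x hx => ?_⟩
  have hJ : ∑ q ∈ Finset.Icc 1 ⌊x⌋₊, jordanTotient β q =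
      ∑ d ∈ Finset.Ioc 0 ⌊x⌋₊, ((moebius d : ℤ) : ℝ) *
        ∑ m ∈ Finset.Ioc 0 ⌊x / d⌋₊, (m : ℝ) ^ β := by
    have h := sum_Ioc_mul_eq_sum_sum (moebius : ArithmeticFunction ℝ)
      (ArithmeticFunction.pow β : ArithmeticFunction ℝ) ⌊x⌋₊
    have hβ0 : β ≠ 0 := by omega
    simp only [natCoe_apply, intCoe_apply, pow_apply, hβ0, false_and, if_false,
      Nat.cast_pow, ← Nat.floor_div_natCast] at h
    exact h
  have hA : HasSum (fun d : ℕ => (((moebius d : ℤ) : ℝ) *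
      ∑ m ∈ Finset.Ioc 0 ⌊x / d⌋₊, (m : ℝ) ^ β : ℝ))
      (∑ q ∈ Finset.Icc 1 ⌊x⌋₊, jordanTotient β q) := by
    rw [hJ]
    refine hasSum_sum_of_ne_finset_zero fun d hd => ?_
    rcases Nat.eq_zero_or_pos d with rfl | hd0
    · simp
    · have hlt : ⌊x⌋₊ < d := by
        simp only [Finset.mem_Ioc, not_and, not_le] at hd
        exact hd hd0
      rw [Nat.floor_div_natCast, Nat.div_eq_of_lt hlt]
      simp
  have hB := (hasSum_moebius_div_pow (k := β + 1) (by omega)).mul_left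
    ((x ^ (1 + β) : ℝ) / (1 + (β : ℂ)) : ℂ)
  have hC := (Complex.hasSum_ofReal.2 hA).sub hB
  have hval : ((x ^ (1 + β) : ℝ) : ℂ) / ((1 + (β : ℂ)) * riemannZeta (1 + (β : ℂ))) =
      ((x ^ (1 + β) : ℝ) / (1 + (β : ℂ)) : ℂ) * (riemannZeta ((β + 1 : ℕ) : ℂ))⁻¹ := by
    push_cast
    rw [add_comm (β : ℂ) 1, div_mul_eq_div_div, div_eq_mul_inv _ (riemannZeta _)]
  rw [hval, ← tsum_mul_right]
  refine hC.norm_le_of_bounded (hsum.mul_right _).hasSum fun d => ?_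
  rcases Nat.eq_zero_or_pos d with rfl | hd0
  · simp; positivity
  have hdR : (0 : ℝ) < d := by exact_mod_cast hd0
  have hdC : (d : ℂ) ≠ 0 := by exact_mod_cast hd0.ne'
  have hβC : (1 + (β : ℂ)) ≠ 0 := by exact_mod_cast (by omega : 1 + β ≠ 0)
  have hre : (((moebius d : ℤ) : ℝ) * ∑ m ∈ Finset.Ioc 0 ⌊x / d⌋₊, (m : ℝ) ^ β : ℝ) -
      ((x ^ (1 + β) : ℝ) / (1 + (β : ℂ)) : ℂ) * (((moebius d : ℤ) : ℂ) / (d : ℂ) ^ (β + 1)) =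
      ((((moebius d : ℤ) : ℝ) * (∑ m ∈ Finset.Ioc 0 ⌊x / d⌋₊, (m : ℝ) ^ β -
        (x / d) ^ (β + 1) / (β + 1)) : ℝ) : ℂ) := by
    have hβC' : ((β : ℂ) + 1) ≠ 0 := by rwa [add_comm]
    push_cast
    rw [div_pow, mul_sub, add_comm 1 β, add_comm 1 (β : ℂ)]
    congr 1
    field_simp
  have hmu : |((moebius d : ℤ) : ℝ)| ≤ 1 := by exact_mod_cast abs_moebius_le_one (n := d)
  rw [hre, Complex.norm_real, Real.norm_eq_abs, abs_mul]
  calc _ ≤ 1 * (x / d) ^ β := mul_le_mul hmu (abs_sum_pow_sub_le β (by positivity))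
        (abs_nonneg _) zero_le_one
    _ = _ := by rw [div_pow]; ring

lemma momentC_two_eq_ofReal {β : ℕ} (hβ : β ≠ 0) (x y : ℝ) :
    momentC 2 β x y = ((∑ q ∈ Finset.Icc 1 ⌊x⌋₊, ∑ r ∈ Finset.Icc 1 ⌊x⌋₊,
      ∑ n ∈ Finset.Icc 1 ⌊y⌋₊, cohenRamanujanReal β q n * cohenRamanujanReal β r n : ℝ) : ℂ) := by
  have h1 : ∀ n, ∑ q ∈ Finset.Icc 1 ⌊x⌋₊, cohenRamanujan β q n =
      ((∑ q ∈ Finset.Icc 1 ⌊x⌋₊, cohenRamanujanReal β q n : ℝ) : ℂ) := by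
    intro n
    push_cast
    exact Finset.sum_congr rfl fun q hq => cohenRamanujan_eq_ofReal hβ (Finset.mem_Icc.1 hq).1 n
  simp only [momentC, h1, ← Complex.ofReal_pow, ← Complex.ofReal_sum]
  congr 1
  simp only [sq, Finset.sum_mul_sum]
  rw [Finset.sum_comm]
  exact Finset.sum_congr rfl fun q _ => Finset.sum_comm

lemma abs_sum_correlation_sub_le {β : ℕ} (hβ : β ≠ 0) {x y : ℝ} (hx : 0 ≤ x) (hy : 0 ≤ y) :
    |∑ q ∈ Finset.Icc 1 ⌊x⌋₊, ∑ r ∈ Finset.Icc 1 ⌊x⌋₊,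
        ∑ n ∈ Finset.Icc 1 ⌊y⌋₊, cohenRamanujanReal β q n * cohenRamanujanReal β r n
      - y * ∑ q ∈ Finset.Icc 1 ⌊x⌋₊, jordanTotient β q| ≤ x ^ (2 * β + 2) := by
  have hdiag : ∑ q ∈ Finset.Icc 1 ⌊x⌋₊, jordanTotient β q =
      ∑ q ∈ Finset.Icc 1 ⌊x⌋₊, ∑ r ∈ Finset.Icc 1 ⌊x⌋₊,
        if q = r then jordanTotient β q else 0 := by
    refine Finset.sum_congr rfl fun q hq => ?_
    rw [Finset.sum_ite_eq, if_pos hq]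
  rw [hdiag, Finset.mul_sum, ← Finset.sum_sub_distrib]
  calc _ ≤ ∑ q ∈ Finset.Icc 1 ⌊x⌋₊, ∑ r ∈ Finset.Icc 1 ⌊x⌋₊,
        (∑ d ∈ q.divisors, (d : ℝ) ^ β) * ∑ e ∈ r.divisors, (e : ℝ) ^ β := by
        refine (Finset.abs_sum_le_sum_abs _ _).trans (Finset.sum_le_sum fun q hq => ?_)
        rw [Finset.mul_sum, ← Finset.sum_sub_distrib]
        refine (Finset.abs_sum_le_sum_abs _ _).trans (Finset.sum_le_sum fun r hr => ?_)
        exact abs_sum_cohenRamanujanReal_mul_sub_le hβ (Finset.mem_Icc.1 hq).1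
          (Finset.mem_Icc.1 hr).1 hy
    _ ≤ ((⌊x⌋₊ : ℝ) ^ (β + 1)) ^ 2 := by
        rw [← Finset.sum_mul_sum, ← sq]
        exact pow_le_pow_left₀ (Finset.sum_nonneg fun q _ => Finset.sum_nonneg fun d _ => by
          positivity) (sum_sum_divisors_pow_le hβ _) 2
    _ ≤ (x ^ (β + 1)) ^ 2 := by
        gcongr
        exact Nat.floor_le hx
    _ = _ := by ring

theorem second_moment_sharp_large_beta (β : ℕ) (hβ : 3 ≤ β) :
    ∃ C > 0, ∀ x y : ℝ, 3 ≤ x → x ^ ((3 * (β : ℝ)) / 2) < y →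
      ‖momentC 2 β x y -
          ((y * x ^ (1 + β) : ℝ) : ℂ) / ((1 + (β : ℂ)) * riemannZeta (1 + (β : ℂ)))‖ ≤
        C * (x ^ (2 * β) * y ^ ((1 : ℝ) / 3 + 1 / (6 * (β : ℝ))) * (Real.log y) ^ 5 *
              Real.log (Real.log y) * ((Real.log x) ^ 4 + (Real.log (Real.log x)) ^ 4)
          + y * x ^ ((1 : ℝ) / 2 + (β : ℝ)) *
              ((Real.log x) ^ 3 + (Real.log (Real.log x)) ^ 3)) := by
  obtain ⟨K, hK, hJ⟩ := exists_norm_sum_jordanTotient_sub_le (β := β) (by omega)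
  refine ⟨K + 1, by positivity, fun x y hx hxy => ?_⟩
  have hβR : (3 : ℝ) ≤ β := by exact_mod_cast hβ
  have hx0 : 0 < x := by linarith
  have hx1 : 1 ≤ x := by linarith
  have hxy' : x ≤ y := by
    refine le_trans ?_ hxy.le
    calc x = x ^ (1 : ℝ) := (Real.rpow_one x).symm
      _ ≤ _ := Real.rpow_le_rpow_of_exponent_le hx1 (by linarith)
  have hy0 : 0 < y := by linarith
  have hlog : ∀ t : ℝ, 3 ≤ t → 1 ≤ Real.log t ∧ 0 ≤ Real.log (Real.log t) := fun t ht => by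
    have : 1 ≤ Real.log t := by
      rw [Real.le_log_iff_exp_le (by linarith)]
      linarith [Real.exp_one_lt_d9]
    exact ⟨this, Real.log_nonneg this⟩
  obtain ⟨hlx, hllx⟩ := hlog x hx
  obtain ⟨hly, hlly⟩ := hlog y (hx.trans hxy')
  have hsecond : y * x ^ ((1 : ℝ) / 2 + (β : ℝ)) ≤ y * x ^ ((1 : ℝ) / 2 + (β : ℝ)) *
      ((Real.log x) ^ 3 + (Real.log (Real.log x)) ^ 3) :=
    le_mul_of_one_le_right (by positivity)
      (by linarith [one_le_pow₀ hlx (n := 3), pow_nonneg hllx 3])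
  have hfirst : 0 ≤ x ^ (2 * β) * y ^ ((1 : ℝ) / 3 + 1 / (6 * (β : ℝ))) * (Real.log y) ^ 5 *
      Real.log (Real.log y) * ((Real.log x) ^ 4 + (Real.log (Real.log x)) ^ 4) := by
    have : 0 ≤ Real.log x := by linarith
    have : 0 ≤ Real.log y := by linarith
    positivity
  have hfloor : x ^ (2 * β + 2) ≤ y * x ^ ((1 : ℝ) / 2 + (β : ℝ)) := by
    calc x ^ (2 * β + 2) = x ^ ((2 * β + 2 : ℕ) : ℝ) := (Real.rpow_natCast x _).symm
      _ ≤ x ^ ((3 * (β : ℝ)) / 2 + ((1 : ℝ) / 2 + (β : ℝ))) :=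
          Real.rpow_le_rpow_of_exponent_le hx1 (by push_cast; linarith)
      _ = x ^ ((3 * (β : ℝ)) / 2) * x ^ ((1 : ℝ) / 2 + (β : ℝ)) := Real.rpow_add hx0 _ _
      _ ≤ _ := by gcongr
  have hpow : x ^ β ≤ x ^ ((1 : ℝ) / 2 + (β : ℝ)) := by
    rw [← Real.rpow_natCast x β]
    exact Real.rpow_le_rpow_of_exponent_le hx1 (by linarith)
  set J := ∑ q ∈ Finset.Icc 1 ⌊x⌋₊, jordanTotient β q with hJdef
  set T := ∑ q ∈ Finset.Icc 1 ⌊x⌋₊, ∑ r ∈ Finset.Icc 1 ⌊x⌋₊,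
    ∑ n ∈ Finset.Icc 1 ⌊y⌋₊, cohenRamanujanReal β q n * cohenRamanujanReal β r n with hT
  have hcorr : |T - y * J| ≤ x ^ (2 * β + 2) :=
    abs_sum_correlation_sub_le (by omega) hx0.le hy0.le
  set Z := (1 + (β : ℂ)) * riemannZeta (1 + (β : ℂ)) with hZ
  have hsplit : momentC 2 β x y - ((y * x ^ (1 + β) : ℝ) : ℂ) / Z =
      ((T - y * J : ℝ) : ℂ) + (y : ℂ) * ((J : ℂ) - ((x ^ (1 + β) : ℝ) : ℂ) / Z) := by
    rw [momentC_two_eq_ofReal (by omega), ← hT]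
    push_cast
    ring
  rw [hsplit]
  calc _ ≤ x ^ (2 * β + 2) + y * (K * x ^ β) := by
        refine (norm_add_le _ _).trans (add_le_add ?_ ?_)
        · rwa [Complex.norm_real, Real.norm_eq_abs]
        · rw [norm_mul, Complex.norm_real, Real.norm_of_nonneg hy0.le]
          exact mul_le_mul_of_nonneg_left (hJ x hx0.le) hy0.le
    _ ≤ y * x ^ ((1 : ℝ) / 2 + (β : ℝ)) + y * (K * x ^ ((1 : ℝ) / 2 + (β : ℝ))) := by gcongr
    _ = (K + 1) * (y * x ^ ((1 : ℝ) / 2 + (β : ℝ))) := by ring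
    _ ≤ _ := by
        refine mul_le_mul_of_nonneg_left ?_ (by positivity)
        linarith
end
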